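/- arXiv:math/0606752 — 3 statements merged into one kernel-verified Lean document; each statement's English description precedes it below -/
import Mathlib

section
/- Let Y be a random vector in ℝ^d with E‖Y‖² < ∞ and σ² = Σ_{k=1}^d Var(Y_k) > 0, where ‖·‖ is the Euclidean norm, and define φ : ℝ^d → ℝ by φ(x) = √(E‖x − Y‖²). Then for every x ∈ ℝ^d, every u ∈ ℝ and every k ∈ {1,…,d} (with e_k the k-th canonical basis vector): |φ(x + u e_k) − φ(x)| ≤ |u|, and (φ(x + u e_k) − φ(x))² ≤ 8u²·E[(x_k − Y_k)²]/E[‖x − Y‖²] + 2u⁴/σ². -/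
open MeasureTheory ProbabilityTheory Real
open scoped ENNReal

/-- If `b² = a² + 2um + u²` with `|m| ≤ a`, then `b` and `a` differ by at most `|u|`. -/
lemma abs_sub_le_of_sq_eq {a b m u : ℝ} (ha : 0 ≤ a) (hb : 0 ≤ b) (hm : |m| ≤ a)
    (h : b ^ 2 = a ^ 2 + 2 * u * m + u ^ 2) : |b - a| ≤ |u| := by
  have hum : |u * m| ≤ |u| * a := by
    rw [abs_mul]
    exact mul_le_mul_of_nonneg_left hm (abs_nonneg u)
  obtain ⟨h1, h2⟩ := abs_le.mp hum
  have hu := sq_abs u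
  have hu0 := abs_nonneg u
  rw [abs_le]
  constructor
  · have : a - |u| ≤ b := abs_le_of_sq_le_sq' (by nlinarith) hb |>.2
    linarith
  · have : b ≤ a + |u| := abs_le_of_sq_le_sq' (by nlinarith) (by positivity) |>.2
    linarith

/-- If `b² = a² + 2um + u²` with `m² ≤ s` and `0 < v ≤ a²`, then
`(b - a)² ≤ 8u²s / a² + 2u⁴ / v`. -/
lemma sq_sub_le_of_sq_eq {a b m u s v : ℝ} (ha : 0 ≤ a) (hb : 0 ≤ b) (hm : m ^ 2 ≤ s)
    (hv : 0 < v) (hva : v ≤ a ^ 2) (h : b ^ 2 = a ^ 2 + 2 * u * m + u ^ 2) :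
    (b - a) ^ 2 ≤ 8 * u ^ 2 * s / a ^ 2 + 2 * u ^ 4 / v := by
  have ha2 : 0 < a ^ 2 := hv.trans_le hva
  have hu4 : 0 ≤ 2 * u ^ 4 := by positivity
  have key : (b - a) ^ 2 * a ^ 2 ≤ 8 * u ^ 2 * s + 2 * u ^ 4 := by
    calc (b - a) ^ 2 * a ^ 2 ≤ (b - a) ^ 2 * (b + a) ^ 2 := by
          gcongr
          linarith
      _ = (2 * u * m + u ^ 2) ^ 2 := by
          rw [← mul_pow, show (b - a) * (b + a) = 2 * u * m + u ^ 2 by linear_combination h]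
      _ ≤ 8 * u ^ 2 * m ^ 2 + 2 * u ^ 4 := by nlinarith [sq_nonneg (2 * u * m - u ^ 2)]
      _ ≤ 8 * u ^ 2 * s + 2 * u ^ 4 := by gcongr
  calc (b - a) ^ 2 ≤ (8 * u ^ 2 * s + 2 * u ^ 4) / a ^ 2 := (le_div_iff₀ ha2).mpr key
    _ = 8 * u ^ 2 * s / a ^ 2 + 2 * u ^ 4 / a ^ 2 := add_div _ _ _
    _ ≤ 8 * u ^ 2 * s / a ^ 2 + 2 * u ^ 4 / v := by gcongr

/-- The square of the mean is at most the mean of the square. -/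
lemma sq_integral_le_integral_sq {Ω : Type*} [MeasurableSpace Ω] {μ : Measure Ω}
    [IsProbabilityMeasure μ] {X : Ω → ℝ} (hX : MemLp X 2 μ) :
    (∫ ω, X ω ∂μ) ^ 2 ≤ ∫ ω, X ω ^ 2 ∂μ := by
  have h := variance_eq_sub hX
  have h0 := variance_nonneg X μ
  simp only [Pi.pow_apply] at h
  linarith

/-- Expansion of `‖x + u eₖ - y‖²` in powers of `u`. -/
lemma norm_add_smul_single_sub_sq {d : ℕ} (x y : EuclideanSpace ℝ (Fin d)) (u : ℝ)
    (k : Fin d) :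
    ‖x + u • EuclideanSpace.single k (1 : ℝ) - y‖ ^ 2
      = ‖x - y‖ ^ 2 + 2 * u * (x k - y k) + u ^ 2 := by
  rw [add_sub_right_comm, norm_add_sq_real, inner_smul_right, EuclideanSpace.inner_single_right,
    norm_smul]
  simp
  ring

/-- Increment estimates (eqs. (15)–(16)) in the proof of Theorem 2 of the paper,
for `φ(x) = √(E‖x − Y‖²)` with `E‖Y‖² < ∞` and `σ² = Σₖ Var(Yₖ) > 0`:
`|φ(x + u eₖ) − φ(x)| ≤ |u|` and
`(φ(x + u eₖ) − φ(x))² ≤ 8u² E[(xₖ − Yₖ)²]/E‖x − Y‖² + 2u⁴/σ²`. -/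
theorem stmt12
    {Ω : Type*} [MeasureSpace Ω] [IsProbabilityMeasure (ℙ : Measure Ω)]
    {d : ℕ}
    (Y : Ω → EuclideanSpace ℝ (Fin d)) (hY : Measurable Y)
    (hint : Integrable fun ω => ‖Y ω‖ ^ 2)
    (σ2 : ℝ) (hσ2 : σ2 = ∑ k, variance (fun ω => Y ω k) ℙ) (hσpos : 0 < σ2)
    (φ : EuclideanSpace ℝ (Fin d) → ℝ)
    (hφ : ∀ x, φ x = Real.sqrt (∫ ω, ‖x - Y ω‖ ^ 2))
    (x : EuclideanSpace ℝ (Fin d)) (u : ℝ) (k : Fin d) :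
    |φ (x + u • EuclideanSpace.single k 1) - φ x| ≤ |u| ∧
    (φ (x + u • EuclideanSpace.single k 1) - φ x) ^ 2 ≤
      8 * u ^ 2 * (∫ ω, (x k - Y ω k) ^ 2) / (∫ ω, ‖x - Y ω‖ ^ 2) + 2 * u ^ 4 / σ2 := by
  have hYL : MemLp Y 2 (ℙ : Measure Ω) :=
    (memLp_two_iff_integrable_sq_norm hY.aestronglyMeasurable).mpr hint
  have hZL : MemLp (fun ω => x - Y ω) 2 (ℙ : Measure Ω) := (memLp_const x).sub hYL
  have hZint : Integrable (fun ω => ‖x - Y ω‖ ^ 2) (ℙ : Measure Ω) :=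
    (memLp_two_iff_integrable_sq_norm hZL.1).mp hZL
  have hcm (j : Fin d) : Measurable fun ω => Y ω j := by fun_prop
  have hcL (j : Fin d) : MemLp (fun ω => x j - Y ω j) 2 (ℙ : Measure Ω) :=
    hZL.mono (measurable_const.sub (hcm j)).aestronglyMeasurable
      (ae_of_all _ fun ω => PiLp.norm_apply_le (x - Y ω) j)
  have hsum : ∫ ω, ‖x - Y ω‖ ^ 2 = ∑ j, ∫ ω, (x j - Y ω j) ^ 2 := by
    rw [← integral_finsetSum _ fun j _ => (hcL j).integrable_sq]
    simp [EuclideanSpace.real_norm_sq_eq]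
  have hσle : σ2 ≤ ∫ ω, ‖x - Y ω‖ ^ 2 := by
    rw [hσ2, hsum]
    refine Finset.sum_le_sum fun j _ => ?_
    rw [← variance_const_sub (hcm j).aestronglyMeasurable (x j)]
    exact variance_le_expectation_sq (hcL j).1
  have hms := sq_integral_le_integral_sq (hcL k)
  have hsA : ∫ ω, (x k - Y ω k) ^ 2 ≤ ∫ ω, ‖x - Y ω‖ ^ 2 := by
    rw [hsum]
    exact Finset.single_le_sum (f := fun j => ∫ ω, (x j - Y ω j) ^ 2)
      (fun j _ => integral_nonneg fun ω => sq_nonneg _) (Finset.mem_univ k)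
  have hexp : ∫ ω, ‖x + u • EuclideanSpace.single k (1 : ℝ) - Y ω‖ ^ 2
      = (∫ ω, ‖x - Y ω‖ ^ 2) + 2 * u * (∫ ω, (x k - Y ω k)) + u ^ 2 := by
    have hlin : Integrable (fun ω => 2 * u * (x k - Y ω k)) (ℙ : Measure Ω) :=
      ((hcL k).integrable one_le_two).const_mul _
    have hquad : Integrable (fun ω => ‖x - Y ω‖ ^ 2 + 2 * u * (x k - Y ω k)) (ℙ : Measure Ω) :=
      hZint.add hlin
    simp_rw [norm_add_smul_single_sub_sq]
    rw [integral_add hquad (integrable_const _), integral_add hZint hlin,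
      integral_const_mul]
    simp
  have hφsq (z : EuclideanSpace ℝ (Fin d)) : φ z ^ 2 = ∫ ω, ‖z - Y ω‖ ^ 2 := by
    rw [hφ, Real.sq_sqrt (integral_nonneg fun ω => sq_nonneg _)]
  have hφ0 (z : EuclideanSpace ℝ (Fin d)) : 0 ≤ φ z := by
    rw [hφ]
    exact Real.sqrt_nonneg _
  rw [← hφsq, ← hφsq] at hexp
  rw [← hφsq] at hσle hsA ⊢
  exact ⟨abs_sub_le_of_sq_eq (hφ0 _) (hφ0 _) (abs_le_of_sq_le_sq (hms.trans hsA) (hφ0 x)) hexp,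
    sq_sub_le_of_sq_eq (hφ0 _) (hφ0 _) hms hσpos hσle hexp⟩
end

section
/- There exists a universal constant c > 0 (independent of the dimension) with the following property. Let d ≥ 1 and let X = (X₁,…,X_d) be a random vector whose components are i.i.d., each with the two-sided (symmetric) exponential distribution on ℝ with density x ↦ (1/2)e^{−|x|} with respect to Lebesgue measure. Let f : ℝ^d → ℝ be Lipschitz with constant a > 0 with respect to the Euclidean norm ‖·‖, and let b₁,…,b_d ∈ ℝ satisfy |f(x + u e_k) − f(x)| ≤ b_k|u| for all u ∈ ℝ, x ∈ ℝ^d and k = 1,…,d, with b = max_{1≤k≤d} b_k > 0, where e₁,…,e_d is the canonical basis. Then for all x > 0 and all ε > 0, P( f(X) ≥ f(0) + a√(2d) + aε + x ) ≤ exp( −c·min( x/b , x²/( ab√d + 2abd/ε ) ) ). -/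
open MeasureTheory ProbabilityTheory Real
open scoped ENNReal

lemma vol_add_le {A B : Set ℝ} (hA : A.Nonempty) (hB : B.Nonempty) {c : ℝ}
    (h : ∀ s ∈ A, ∀ t ∈ B, |s + t| ≤ c) :
    volume A + volume B ≤ ENNReal.ofReal (2 * c) := by
  obtain ⟨s₀, hs₀⟩ := hA
  obtain ⟨t₀, ht₀⟩ := hB
  have hAa : BddAbove A := ⟨c - t₀, fun s hs => by have := (abs_le.1 (h s hs t₀ ht₀)).2; linarith⟩
  have hAb : BddBelow A := ⟨-c - t₀, fun s hs => by have := (abs_le.1 (h s hs t₀ ht₀)).1; linarith⟩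
  have hBa : BddAbove B := ⟨c - s₀, fun t ht => by have := (abs_le.1 (h s₀ hs₀ t ht)).2; linarith⟩
  have hBb : BddBelow B := ⟨-c - s₀, fun t ht => by have := (abs_le.1 (h s₀ hs₀ t ht)).1; linarith⟩
  have h1 : sSup A + sSup B ≤ c := by
    have : sSup A ≤ c - sSup B := csSup_le ⟨s₀, hs₀⟩ fun s hs => by
      have : sSup B ≤ c - s := csSup_le ⟨t₀, ht₀⟩ fun t ht => by
        have := (abs_le.1 (h s hs t ht)).2; linarith
      linarith
    linarith
  have h2 : -c ≤ sInf A + sInf B := by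
    have : -c - sInf B ≤ sInf A := le_csInf ⟨s₀, hs₀⟩ fun s hs => by
      have : -c - s ≤ sInf B := le_csInf ⟨t₀, ht₀⟩ fun t ht => by
        have := (abs_le.1 (h s hs t ht)).1; linarith
      linarith
    linarith
  calc volume A + volume B
      ≤ volume (Set.Icc (sInf A) (sSup A)) + volume (Set.Icc (sInf B) (sSup B)) := by
        gcongr
        · exact fun s hs => ⟨csInf_le hAb hs, le_csSup hAa hs⟩
        · exact fun s hs => ⟨csInf_le hBb hs, le_csSup hBa hs⟩
    _ = ENNReal.ofReal ((sSup A - sInf A) + (sSup B - sInf B)) := by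
        rw [Real.volume_Icc, Real.volume_Icc, ENNReal.ofReal_add]
        · linarith [csInf_le hAb hs₀, le_csSup hAa hs₀]
        · linarith [csInf_le hBb ht₀, le_csSup hBa ht₀]
    _ ≤ _ := by gcongr; linarith

lemma lintegral_add_lintegral_le {p q : ℝ → ℝ} (hpm : Measurable p) (hqm : Measurable q)
    (hp0 : ∀ s, 0 ≤ p s) (hq0 : ∀ s, 0 ≤ q s) (hp1 : ∀ s, p s ≤ 1) (hq1 : ∀ s, q s ≤ 1)
    (hp : ∀ r < 1, ∃ s, r < p s) (hq : ∀ r < 1, ∃ s, r < q s) {γ : ℝ} (hγ : 0 < γ)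
    (h : ∀ s t, γ ^ 2 * (p s * q t) ≤ (max 0 (1 - |(s + t) / 2|)) ^ 2) :
    (∫⁻ s, ENNReal.ofReal (p s)) + ∫⁻ s, ENNReal.ofReal (q s) ≤ ENNReal.ofReal (4 - 2 * γ) := by
  have key : ∀ r : ℝ, 0 < r → ∀ s t, r < p s → r < q t → |(s + t) / 2| ≤ 1 - γ * r := by
    intro r hr s t hs ht
    have h1 : (γ * r) ^ 2 < (max 0 (1 - |(s + t) / 2|)) ^ 2 := by
      refine lt_of_lt_of_le ?_ (h s t)
      rw [mul_pow, sq r]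
      have : r * r < p s * q t := mul_lt_mul'' hs ht hr.le hr.le
      gcongr
    have h2 := lt_of_pow_lt_pow_left₀ 2 (le_max_left _ _) h1
    rcases lt_max_iff.1 h2 with h3 | h3
    · have := mul_pos hγ hr
      linarith
    · linarith
  have hvol : ∀ r ∈ Set.Ioo (0 : ℝ) 1, volume {s | r < p s} + volume {s | r < q s} ≤
      ENNReal.ofReal (4 - 4 * γ * r) := by
    intro r hr
    refine (vol_add_le (hp r hr.2) (hq r hr.2) (c := 2 * (1 - γ * r)) ?_).trans_eq ?_
    · intro s hs t ht
      have := key r hr.1 s t hs ht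
      rw [abs_div, abs_two] at this
      linarith
    · congr 1
      ring
  have hnn : ∀ r ∈ Set.Ioo (0 : ℝ) 1, 0 ≤ 4 - 4 * γ * r := by
    intro r hr
    obtain ⟨s, hs⟩ := hp r hr.2
    obtain ⟨t, ht⟩ := hq r hr.2
    have := (abs_nonneg _).trans (key r hr.1 s t hs ht)
    linarith
  have hanti : Antitone fun r => volume {s | r < p s} := fun r r' hr =>
    measure_mono fun s hs => lt_of_le_of_lt hr hs
  rw [lintegral_eq_lintegral_meas_lt _ (ae_of_all _ hp0) hpm.aemeasurable,
    lintegral_eq_lintegral_meas_lt _ (ae_of_all _ hq0) hqm.aemeasurable,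
    ← lintegral_add_left hanti.measurable]
  have hInt : IntegrableOn (fun r : ℝ => 4 - 4 * γ * r) (Set.Ioo 0 1) := by
    refine IntegrableOn.mono_set (t := Set.Icc 0 1) ?_ Set.Ioo_subset_Icc_self
    exact Continuous.integrableOn_Icc (by fun_prop)
  calc ∫⁻ r in Set.Ioi 0, (volume {s | r < p s} + volume {s | r < q s})
      ≤ ∫⁻ r in Set.Ioi 0, (Set.Ioo (0 : ℝ) 1).indicator
          (fun r => ENNReal.ofReal (4 - 4 * γ * r)) r := by
        refine setLIntegral_mono' measurableSet_Ioi fun r hr => ?_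
        by_cases hr1 : r < 1
        · rw [Set.indicator_of_mem (show r ∈ Set.Ioo (0 : ℝ) 1 from ⟨hr, hr1⟩)]
          exact hvol r ⟨hr, hr1⟩
        · have e1 : {s | r < p s} = ∅ := Set.eq_empty_of_forall_notMem fun s hs =>
            hr1 (lt_of_lt_of_le hs (hp1 s))
          have e2 : {s | r < q s} = ∅ := Set.eq_empty_of_forall_notMem fun s hs =>
            hr1 (lt_of_lt_of_le hs (hq1 s))
          simp [e1, e2]
    _ ≤ ∫⁻ r, (Set.Ioo (0 : ℝ) 1).indicator (fun r => ENNReal.ofReal (4 - 4 * γ * r)) r :=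
        setLIntegral_le_lintegral _ _
    _ = ENNReal.ofReal (∫ r in Set.Ioo (0 : ℝ) 1, (4 - 4 * γ * r)) := by
        rw [lintegral_indicator measurableSet_Ioo,
          ofReal_integral_eq_lintegral_ofReal hInt
            ((ae_restrict_iff' measurableSet_Ioo).2 (ae_of_all _ hnn))]
    _ = _ := by
        rw [← integral_Ioc_eq_integral_Ioo, ← intervalIntegral.integral_of_le zero_le_one,
          intervalIntegral.integral_sub (by simp) (by apply Continuous.intervalIntegrable; fun_prop),
          intervalIntegral.integral_const_mul, integral_id]
        simp
        ring_nf

/-- A Prékopa–Leindler inequality for the triangular density on `(-1, 1)`. -/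
lemma lintegral_mul_lintegral_le_one {P Q : ℝ → ℝ≥0∞} (hP : Measurable P) (hQ : Measurable Q)
    (h : ∀ s t, P s * Q t ≤ ENNReal.ofReal (1 - |(s + t) / 2|) ^ 2) :
    (∫⁻ s, P s) * ∫⁻ t, Q t ≤ 1 := by
  set α := ⨆ s, P s with hα
  set β := ⨆ t, Q t with hβ
  have hle1 : ∀ s t, P s * Q t ≤ 1 := fun s t => (h s t).trans <| by
    refine pow_le_one₀ (zero_le) (ENNReal.ofReal_le_one.2 ?_)
    linarith [abs_nonneg ((s + t) / 2)]
  have hαQ : ∀ t, α * Q t ≤ 1 := fun t => by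
    rw [hα, ENNReal.iSup_mul]
    exact iSup_le fun s => hle1 s t
  have hαβ : α * β ≤ 1 := by
    rw [hβ, ENNReal.mul_iSup]
    exact iSup_le hαQ
  by_cases hα0 : α = 0
  · have : ∀ s, P s = 0 := fun s => le_antisymm ((le_iSup P s).trans_eq hα0) zero_le
    simp [this]
  by_cases hβ0 : β = 0
  · have : ∀ s, Q s = 0 := fun s => le_antisymm ((le_iSup Q s).trans_eq hβ0) zero_le
    simp [this]
  have hαt : α ≠ ∞ := fun h' => by simp [h', ENNReal.top_mul hβ0] at hαβ
  have hβt : β ≠ ∞ := fun h' => by simp [h', ENNReal.mul_top hα0] at hαβ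
  have hαp : 0 < α.toReal := ENNReal.toReal_pos hα0 hαt
  have hβp : 0 < β.toReal := ENNReal.toReal_pos hβ0 hβt
  have hPt : ∀ s, P s ≠ ∞ := fun s => ne_top_of_le_ne_top hαt (le_iSup P s)
  have hQt : ∀ s, Q s ≠ ∞ := fun s => ne_top_of_le_ne_top hβt (le_iSup Q s)
  set γ := √(α.toReal * β.toReal) with hγ
  have hγ0 : 0 < γ := Real.sqrt_pos.2 (by positivity)
  have hγ2 : γ ^ 2 = α.toReal * β.toReal := Real.sq_sqrt (by positivity)
  have hex : ∀ (R : ℝ → ℝ≥0∞), (∀ s, R s ≠ ∞) → (⨆ s, R s) ≠ 0 → (⨆ s, R s) ≠ ∞ → ∀ r < (1 : ℝ),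
      ∃ s, r < (R s).toReal / (⨆ s, R s).toReal := by
    intro R hR h0 ht r hr
    have hpos := ENNReal.toReal_pos h0 ht
    have : ENNReal.ofReal (r * (⨆ s, R s).toReal) < ⨆ s, R s := by
      rw [← ENNReal.ofReal_toReal ht, ENNReal.toReal_ofReal hpos.le,
        ENNReal.ofReal_lt_ofReal_iff hpos]
      nlinarith
    obtain ⟨s, hs⟩ := lt_iSup_iff.1 this
    refine ⟨s, ?_⟩
    rw [lt_div_iff₀ hpos]
    rw [← ENNReal.ofReal_toReal (hR s)] at hs
    exact lt_of_not_ge fun h' => hs.not_ge (ENNReal.ofReal_le_ofReal h')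
  have main := lintegral_add_lintegral_le (p := fun s => (P s).toReal / α.toReal)
    (q := fun s => (Q s).toReal / β.toReal) (hP.ennreal_toReal.div_const _)
    (hQ.ennreal_toReal.div_const _) (fun s => by positivity) (fun s => by positivity)
    (fun s => div_le_one_of_le₀ (ENNReal.toReal_mono hαt (le_iSup P s)) hαp.le)
    (fun s => div_le_one_of_le₀ (ENNReal.toReal_mono hβt (le_iSup Q s)) hβp.le)
    (hex P hPt hα0 hαt) (hex Q hQt hβ0 hβt) hγ0 (fun s t => by
      have h1 := ENNReal.toReal_mono (by finiteness) (h s t)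
      rw [ENNReal.toReal_mul, ENNReal.toReal_pow, ENNReal.toReal_ofReal', max_comm] at h1
      convert h1 using 1
      rw [hγ2]
      field_simp)
  have hsc : ∀ (R : ℝ → ℝ≥0∞) (_ : Measurable R) (_ : ∀ s, R s ≠ ∞) (c : ℝ≥0∞) (_ : c ≠ 0)
      (_ : c ≠ ∞), ∫⁻ s, R s = c * ∫⁻ s, ENNReal.ofReal ((R s).toReal / c.toReal) := by
    intro R hRm hR c h0 ht
    rw [← lintegral_const_mul _ (by fun_prop)]
    refine lintegral_congr fun s => ?_
    rw [ENNReal.ofReal_div_of_pos (ENNReal.toReal_pos h0 ht), ENNReal.ofReal_toReal (hR s),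
      ENNReal.ofReal_toReal ht, ENNReal.mul_div_cancel h0 ht]
  rw [hsc P hP hPt α hα0 hαt, hsc Q hQ hQt β hβ0 hβt]
  set I := ∫⁻ s, ENNReal.ofReal ((P s).toReal / α.toReal)
  set J := ∫⁻ s, ENNReal.ofReal ((Q s).toReal / β.toReal)
  have hIJ : I + J ≠ ∞ := ne_top_of_le_ne_top ENNReal.ofReal_ne_top main
  have hI : I ≠ ∞ := fun h' => hIJ (by simp [h'])
  have hJ : J ≠ ∞ := fun h' => hIJ (by simp [h'])
  have hne : α * I * (β * J) ≠ ∞ := by finiteness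
  rw [← ENNReal.toReal_le_toReal hne ENNReal.one_ne_top]
  simp only [ENNReal.toReal_mul, ENNReal.toReal_one]
  have hi := ENNReal.toReal_nonneg (a := I)
  have hj := ENNReal.toReal_nonneg (a := J)
  have hsum : I.toReal + J.toReal ≤ max (4 - 2 * γ) 0 := by
    rw [← ENNReal.toReal_add hI hJ, ← ENNReal.toReal_ofReal']
    exact ENNReal.toReal_mono ENNReal.ofReal_ne_top main
  have hγ1 : γ ≤ 1 := by
    rw [hγ, Real.sqrt_le_one]
    rw [← ENNReal.toReal_mul, ← ENNReal.toReal_one]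
    exact ENNReal.toReal_mono ENNReal.one_ne_top hαβ
  rw [max_eq_left (by linarith)] at hsum
  have hprod : I.toReal * J.toReal ≤ (2 - γ) ^ 2 := by
    nlinarith [sq_nonneg (I.toReal - J.toReal)]
  calc α.toReal * I.toReal * (β.toReal * J.toReal)
      = γ ^ 2 * (I.toReal * J.toReal) := by rw [hγ2]; ring
    _ ≤ γ ^ 2 * (2 - γ) ^ 2 := by gcongr
    _ = (γ * (2 - γ)) ^ 2 := by ring
    _ ≤ 1 := pow_le_one₀ (by nlinarith) (by nlinarith [sq_nonneg (γ - 1)])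

/-- The two-sided exponential distribution. -/
noncomputable def symmExp : Measure ℝ :=
  (volume : Measure ℝ).withDensity fun t => ENNReal.ofReal ((1/2) * Real.exp (-|t|))

lemma cosh_half_log_sq {r : ℝ} (hr : 0 < r) : cosh (log r / 2) ^ 2 = (1 + r) ^ 2 / (4 * r) := by
  have h := Real.cosh_sq' (log r / 2)
  have h2 := Real.cosh_two_mul (log r / 2)
  rw [mul_div_cancel₀ _ (two_ne_zero), Real.cosh_log hr] at h2
  have : cosh (log r / 2) ^ 2 = ((r + r⁻¹) / 2 + 1) / 2 := by linarith
  rw [this]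
  field_simp
  ring

/-- Transports the triangular density on `(-1, 1)` to the two-sided exponential one. -/
noncomputable def triangleToSymmExp (t : ℝ) : ℝ :=
  if 0 ≤ t then -2 * log (1 - t) else 2 * log (1 + t)

lemma measurable_triangleToSymmExp : Measurable triangleToSymmExp := by
  unfold triangleToSymmExp
  exact Measurable.ite measurableSet_Ici (by fun_prop) (by fun_prop)

lemma cosh_triangleToSymmExp_le {s t : ℝ} (hs : |s| < 1) (ht : |t| < 1) :
    cosh ((triangleToSymmExp s - triangleToSymmExp t) / 4) ^ 2 * ((1 - |s|) * (1 - |t|)) ≤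
      (1 - |(s + t) / 2|) ^ 2 := by
  have same : ∀ {p q : ℝ}, 0 < p → 0 < q →
      cosh ((2 * log p - 2 * log q) / 4) ^ 2 * (p * q) = ((p + q) / 2) ^ 2 := by
    intro p q hp hq
    have : (2 * log p - 2 * log q) / 4 = log (p / q) / 2 := by
      rw [Real.log_div hp.ne' hq.ne']
      ring
    rw [this, cosh_half_log_sq (by positivity)]
    field_simp
    ring
  have diff : ∀ {p q : ℝ}, 0 < p → 0 < q → p ≤ 1 → q ≤ 1 →
      cosh ((2 * log p + 2 * log q) / 4) ^ 2 * (p * q) ≤ (1 - |(p - q) / 2|) ^ 2 := by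
    intro p q hp hq hp1 hq1
    have : (2 * log p + 2 * log q) / 4 = log (p * q) / 2 := by
      rw [Real.log_mul hp.ne' hq.ne']
      ring
    rw [this, cosh_half_log_sq (by positivity)]
    have h1 : (1 + p * q) ^ 2 / (4 * (p * q)) * (p * q) = ((1 + p * q) / 2) ^ 2 := by
      field_simp
      ring
    rw [h1]
    gcongr
    rw [le_sub_comm, abs_le]
    constructor <;> nlinarith
  obtain ⟨hs1, hs2⟩ := abs_lt.1 hs
  obtain ⟨ht1, ht2⟩ := abs_lt.1 ht
  unfold triangleToSymmExp
  split_ifs with h1 h2 h2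
  · rw [abs_of_nonneg h1, abs_of_nonneg h2, abs_of_nonneg (by positivity : 0 ≤ (s + t) / 2)]
    refine le_of_eq ?_
    rw [← Real.cosh_neg]
    convert same (p := 1 - s) (q := 1 - t) (by linarith) (by linarith) using 1
    · ring_nf
    · ring
  · rw [abs_of_nonneg h1, abs_of_neg (not_le.1 h2), ← Real.cosh_neg]
    convert diff (p := 1 - s) (q := 1 + t) (by linarith) (by linarith) (by linarith)
      (by linarith) using 1
    · ring_nf
    · rw [← abs_neg]
      ring_nf
  · rw [abs_of_nonneg h2, abs_of_neg (not_le.1 h1)]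
    convert diff (p := 1 + s) (q := 1 - t) (by linarith) (by linarith) (by linarith)
      (by linarith) using 1
    · ring_nf
    · ring_nf
  · rw [abs_of_neg (not_le.1 h1), abs_of_neg (not_le.1 h2),
      abs_of_neg (by linarith : (s + t) / 2 < 0)]
    refine le_of_eq ?_
    convert same (p := 1 + s) (q := 1 + t) (by linarith) (by linarith) using 1
    · ring_nf
    · ring

/-- Inverse of `triangleToSymmExp` on `(-1, 1)`. -/
noncomputable def symmExpToTriangle (x : ℝ) : ℝ :=
  if 0 ≤ x then 1 - rexp (-x / 2) else rexp (x / 2) - 1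

lemma abs_symmExpToTriangle (x : ℝ) : |symmExpToTriangle x| = 1 - rexp (-|x| / 2) := by
  unfold symmExpToTriangle
  split_ifs with h
  · rw [abs_of_nonneg h, abs_of_nonneg]
    exact sub_nonneg.2 (Real.exp_le_one_iff.2 (by linarith))
  · have hx := not_le.1 h
    rw [abs_of_neg hx, abs_of_nonpos]
    · ring_nf
    · exact sub_nonpos.2 (Real.exp_le_one_iff.2 (by linarith))

lemma triangleToSymmExp_symmExpToTriangle (x : ℝ) :
    triangleToSymmExp (symmExpToTriangle x) = x := by
  unfold symmExpToTriangle triangleToSymmExp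
  split_ifs with h h' h'
  · simp
    ring
  · exact absurd (sub_nonneg.2 (Real.exp_le_one_iff.2 (by linarith))) h'
  · exact absurd (Real.exp_lt_one_iff.2 (by linarith : x / 2 < 0)) (by linarith)
  · simp
    ring

lemma hasDerivAt_symmExpToTriangle {x : ℝ} (hx : x ≠ 0) :
    HasDerivAt symmExpToTriangle (rexp (-|x| / 2) / 2) x := by
  rcases lt_or_gt_of_ne hx with h | h
  · have hd : HasDerivAt (fun x : ℝ => rexp (x / 2) - 1) (rexp (x / 2) * (1 / 2)) x :=
      (((hasDerivAt_id x).div_const 2).exp).sub_const 1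
    have := hd.congr_of_eventuallyEq (f₁ := symmExpToTriangle) <| by
      filter_upwards [eventually_lt_nhds h] with y hy
      simp [symmExpToTriangle, not_le.2 hy]
    rwa [abs_of_neg h, neg_neg, ← mul_one_div]
  · have hd : HasDerivAt (fun x : ℝ => 1 - rexp (-x / 2)) (-(rexp (-x / 2) * (-1 / 2))) x :=
      ((((hasDerivAt_id x).neg).div_const 2).exp).const_sub 1
    have := hd.congr_of_eventuallyEq (f₁ := symmExpToTriangle) <| by
      filter_upwards [eventually_gt_nhds h] with y hy
      simp [symmExpToTriangle, hy.le]
    rwa [abs_of_pos h, show rexp (-x / 2) / 2 = -(rexp (-x / 2) * (-1 / 2)) by ring]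

lemma lintegral_symmExp (F : ℝ → ℝ≥0∞) (hF : Measurable F) :
    ∫⁻ x, F x ∂symmExp = ∫⁻ x, ENNReal.ofReal ((1 / 2) * rexp (-|x|)) * F x := by
  rw [symmExp, lintegral_withDensity_eq_lintegral_mul _ (by fun_prop) hF]
  rfl

lemma lintegral_symmExp_le (F : ℝ → ℝ≥0∞) (hF : Measurable F) :
    ∫⁻ x, F x ∂symmExp ≤
      ∫⁻ t, ENNReal.ofReal (1 - |t|) * F (triangleToSymmExp t) := by
  have himage := lintegral_image_eq_lintegral_abs_deriv_mul (s := {0}ᶜ) (f := symmExpToTriangle)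
    (measurableSet_singleton 0).compl
    (fun x hx => (hasDerivAt_symmExpToTriangle hx).hasDerivWithinAt)
    (Function.LeftInverse.injective triangleToSymmExp_symmExpToTriangle).injOn
    (fun t => ENNReal.ofReal (1 - |t|) * F (triangleToSymmExp t))
  rw [lintegral_symmExp F hF]
  refine le_trans (le_of_eq ?_) (setLIntegral_le_lintegral (symmExpToTriangle '' {0}ᶜ) _)
  rw [himage, restrict_compl_singleton]
  refine lintegral_congr fun x => ?_
  rw [triangleToSymmExp_symmExpToTriangle, abs_symmExpToTriangle, ← mul_assoc,
    ← ENNReal.ofReal_mul (abs_nonneg _), abs_of_nonneg (a := rexp (-|x| / 2) / 2) (by positivity), sub_sub_cancel]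
  congr 2
  rw [div_mul_eq_mul_div (rexp _), ← Real.exp_add]
  ring_nf

/-- Maurey's property (τ) for the two-sided exponential distribution, with the cost function
`u ↦ 2 * log (cosh (u / 4))`, in a form that avoids infimum convolutions. -/
lemma lintegral_mul_lintegral_symmExp_le {F G : ℝ → ℝ≥0∞} (hF : Measurable F) (hG : Measurable G)
    (h : ∀ x y, F x * G y ≤ ENNReal.ofReal (cosh ((x - y) / 4) ^ 2)) :
    (∫⁻ x, F x ∂symmExp) * ∫⁻ y, G y ∂symmExp ≤ 1 := by
  have hmeas := measurable_triangleToSymmExp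
  refine (mul_le_mul' (lintegral_symmExp_le F hF) (lintegral_symmExp_le G hG)).trans ?_
  refine lintegral_mul_lintegral_le_one (by fun_prop) (by fun_prop) fun s t => ?_
  rcases le_or_gt 1 |s| with hs | hs
  · simp [ENNReal.ofReal_of_nonpos (sub_nonpos.2 hs)]
  rcases le_or_gt 1 |t| with ht | ht
  · simp [ENNReal.ofReal_of_nonpos (sub_nonpos.2 ht)]
  have hm : 0 ≤ 1 - |(s + t) / 2| := by
    rw [abs_lt] at hs ht
    rw [sub_nonneg, abs_le]
    constructor <;> linarith
  calc ENNReal.ofReal (1 - |s|) * F (triangleToSymmExp s) *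
        (ENNReal.ofReal (1 - |t|) * G (triangleToSymmExp t))
      = (F (triangleToSymmExp s) * G (triangleToSymmExp t)) *
        (ENNReal.ofReal (1 - |s|) * ENNReal.ofReal (1 - |t|)) := by ring
    _ ≤ ENNReal.ofReal (cosh ((triangleToSymmExp s - triangleToSymmExp t) / 4) ^ 2) *
        (ENNReal.ofReal (1 - |s|) * ENNReal.ofReal (1 - |t|)) := by
        gcongr
        exact h _ _
    _ ≤ _ := by
        rw [← ENNReal.ofReal_mul (by linarith), ← ENNReal.ofReal_mul (by positivity),
          ← ENNReal.ofReal_pow hm]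
        exact ENNReal.ofReal_le_ofReal (cosh_triangleToSymmExp_le hs ht)

lemma integral_symmExp (g : ℝ → ℝ) :
    ∫ x, g |x| ∂symmExp = ∫ x in Set.Ioi 0, rexp (-x) * g x := by
  rw [symmExp, integral_withDensity_eq_integral_toReal_smul (by fun_prop)
    (ae_of_all _ fun x => ENNReal.ofReal_lt_top)]
  have : ∀ x : ℝ, (ENNReal.ofReal (1 / 2 * rexp (-|x|))).toReal • g |x| =
      (fun y => 1 / 2 * (rexp (-y) * g y)) |x| := fun x => by
    rw [ENNReal.toReal_ofReal (by positivity), smul_eq_mul]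
    ring
  simp_rw [this]
  rw [integral_comp_abs (f := fun y => 1 / 2 * (rexp (-y) * g y)), integral_const_mul]
  ring

lemma integral_sq_symmExp : ∫ x, x ^ 2 ∂symmExp = 2 := by
  have h := integral_symmExp (fun x => x ^ 2)
  simp only [sq_abs] at h
  have h2 := Real.Gamma_eq_integral (s := 3) (by norm_num)
  rw [h, ← setIntegral_congr_fun measurableSet_Ioi (f := fun x : ℝ => rexp (-x) * x ^ ((3 : ℝ) - 1)),
    ← h2]
  · have := Real.Gamma_nat_eq_factorial 2
    rw [show ((2 : ℕ) : ℝ) + 1 = 3 by norm_num] at this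
    rw [this]
    norm_num [Nat.factorial]
  · intro x _
    simp only
    norm_num

instance isProbabilityMeasure_symmExp : IsProbabilityMeasure symmExp := by
  have h := integral_symmExp (fun _ => 1)
  simp only [mul_one, integral_exp_neg_Ioi_zero, integral_const, smul_eq_mul] at h
  rw [measureReal_def, ENNReal.toReal_eq_one_iff] at h
  exact ⟨h⟩

lemma lintegral_mul_lintegral_pi_symmExp_le {n : ℕ} {F G : (Fin n → ℝ) → ℝ≥0∞}
    (hF : Measurable F) (hG : Measurable G)
    (h : ∀ x y, F x * G y ≤ ENNReal.ofReal (∏ k, cosh ((x k - y k) / 4) ^ 2)) :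
    (∫⁻ x, F x ∂Measure.pi fun _ => symmExp) * ∫⁻ y, G y ∂Measure.pi (fun _ => symmExp) ≤ 1 := by
  induction n with
  | zero =>
    rw [Measure.pi_of_empty _ Fin.elim0, lintegral_dirac' _ hF, lintegral_dirac' _ hG]
    simpa using h Fin.elim0 Fin.elim0
  | succ n ih =>
    have hcons : Measurable fun z : ℝ × (Fin n → ℝ) => (Fin.cons z.1 z.2 : Fin (n + 1) → ℝ) :=
      measurable_pi_iff.2 fun k => by
        refine Fin.cases ?_ (fun i => ?_) k
        · simpa using measurable_fst
        · simp only [Fin.cons_succ]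
          fun_prop
    have split : ∀ {H : (Fin (n + 1) → ℝ) → ℝ≥0∞}, Measurable H →
        ∫⁻ x, H x ∂Measure.pi (fun _ => symmExp) =
          ∫⁻ v, ∫⁻ t, H (Fin.cons t v) ∂symmExp ∂Measure.pi fun _ => symmExp := by
      intro H hH
      have hsymm : ∀ z, (MeasurableEquiv.piFinSuccAbove (fun _ : Fin (n + 1) => ℝ) 0).symm z =
          Fin.cons z.1 z.2 := fun z => Fin.insertNth_zero' z.1 z.2
      rw [← (measurePreserving_piFinSuccAbove (fun _ : Fin (n + 1) => symmExp) 0).symm.lintegral_comp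
        hH]
      simp_rw [hsymm]
      exact lintegral_prod_symm (μ := symmExp) (ν := Measure.pi fun _ => symmExp)
        (fun z => H (Fin.cons z.1 z.2)) (hH.comp hcons).aemeasurable
    rw [split hF, split hG]
    refine ih (hF.comp hcons).lintegral_prod_left' (hG.comp hcons).lintegral_prod_left' fun v w => ?_
    set C := ENNReal.ofReal (∏ k, cosh ((v k - w k) / 4) ^ 2) with hC
    have hC0 : C ≠ 0 := by
      rw [hC, Ne, ENNReal.ofReal_eq_zero, not_le]
      exact Finset.prod_pos fun k _ => pow_pos (Real.cosh_pos _) 2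
    have hFv : Measurable fun t => F (Fin.cons t v) :=
      (hF.comp hcons).comp (measurable_id.prodMk measurable_const)
    have hGw : Measurable fun t => G (Fin.cons t w) :=
      (hG.comp hcons).comp (measurable_id.prodMk measurable_const)
    have h1 := lintegral_mul_lintegral_symmExp_le (F := fun t => C⁻¹ * F (Fin.cons t v))
      (hFv.const_mul _) hGw (fun s t => by
        have h2 := h (Fin.cons s v) (Fin.cons t w)
        rw [Fin.prod_univ_succ, ENNReal.ofReal_mul (by positivity)] at h2
        simp only [Fin.cons_zero, Fin.cons_succ] at h2
        rw [mul_assoc, mul_comm, ← div_eq_mul_inv]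
        exact ENNReal.div_le_of_le_mul h2)
    rw [lintegral_const_mul _ hFv, mul_assoc] at h1
    rwa [ENNReal.inv_mul_le_iff hC0 ENNReal.ofReal_ne_top, mul_one] at h1

lemma exp_sq_div_le_cosh {u : ℝ} (hu : |u| ≤ 4) : rexp (u ^ 2 / 24) ≤ cosh (u / 4) ^ 2 := by
  have h1 : 1 + (u / 4) ^ 2 / 2 ≤ cosh (u / 4) := by
    have h := Real.cosh_two_mul (u / 8)
    rw [Real.cosh_sq', ← sq_abs (sinh _), Real.abs_sinh] at h
    have h' : |u / 8| ≤ sinh |u / 8| := Real.self_le_sinh_iff.2 (abs_nonneg _)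
    have h'' := pow_le_pow_left₀ (abs_nonneg _) h' 2
    rw [sq_abs] at h''
    rw [show u / 4 = 2 * (u / 8) by ring, h]
    linarith
  have hsq : u ^ 2 ≤ 16 := by
    rw [← sq_abs]
    nlinarith [abs_nonneg u]
  have h2 : rexp (u ^ 2 / 48) ≤ 1 + (u / 4) ^ 2 / 2 := by
    have h3 := Real.one_sub_le_exp_neg (u ^ 2 / 48)
    rw [Real.exp_neg] at h3
    have h4 : 0 < 1 - u ^ 2 / 48 := by linarith
    have h5 := (le_inv_comm₀ h4 (Real.exp_pos _)).1 h3
    refine h5.trans ?_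
    rw [inv_le_iff_one_le_mul₀ h4]
    nlinarith [sq_nonneg u]
  calc rexp (u ^ 2 / 24) = rexp (u ^ 2 / 48) ^ 2 := by
        rw [← Real.exp_nat_mul]
        ring_nf
    _ ≤ _ := by
        gcongr
        exact h2.trans h1

lemma exp_abs_div_le_cosh {u : ℝ} (hu : 4 ≤ |u|) : rexp (|u| / 8) ≤ cosh (u / 4) ^ 2 := by
  have h1 : 2 ≤ rexp (3 * |u| / 16) := by
    have := Real.quadratic_le_exp_of_nonneg (x := 3 * |u| / 16) (by positivity)
    nlinarith
  have h2 : rexp (|u| / 4) / 2 ≤ cosh (u / 4) := by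
    rw [← Real.cosh_abs, Real.cosh_eq, abs_div, abs_of_pos (four_pos (α := ℝ))]
    linarith [Real.exp_pos (-(|u| / 4))]
  have h3 : rexp (|u| / 16) ≤ cosh (u / 4) := by
    refine le_trans ?_ h2
    rw [show |u| / 4 = |u| / 16 + 3 * |u| / 16 by ring, Real.exp_add]
    nlinarith [Real.exp_pos (|u| / 16)]
  calc rexp (|u| / 8) = rexp (|u| / 16) ^ 2 := by
        rw [← Real.exp_nat_mul]
        ring_nf
    _ ≤ _ := by gcongr

section Lipschitz

variable {d : ℕ} {f : EuclideanSpace ℝ (Fin d) → ℝ} {a b : ℝ}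

lemma abs_sub_le_sum_of_coord_lipschitz
    (hb : ∀ (u : ℝ) (x : EuclideanSpace ℝ (Fin d)) (k : Fin d),
      |f (x + u • EuclideanSpace.single k 1) - f x| ≤ b * |u|)
    (y : EuclideanSpace ℝ (Fin d)) (u : Fin d → ℝ) (s : Finset (Fin d)) :
    |f (y + ∑ k ∈ s, u k • EuclideanSpace.single k 1) - f y| ≤ ∑ k ∈ s, b * |u k| := by
  induction s using Finset.induction_on with
  | empty => simp
  | insert k s hk ih =>
    rw [Finset.sum_insert hk, Finset.sum_insert hk, add_comm (u k • _), ← add_assoc]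
    exact (abs_sub_le _ _ _).trans (add_le_add (hb (u k) _ k) ih)

lemma sum_smul_single_apply (u : Fin d → ℝ) (s : Finset (Fin d)) (k : Fin d) :
    (∑ j ∈ s, u j • EuclideanSpace.single j (1 : ℝ)) k = if k ∈ s then u k else 0 := by
  rw [WithLp.ofLp_sum, Finset.sum_apply]
  simp

lemma lipschitz_of_coord_lipschitz (hb0 : 0 ≤ b)
    (hb : ∀ (u : ℝ) (x : EuclideanSpace ℝ (Fin d)) (k : Fin d),
      |f (x + u • EuclideanSpace.single k 1) - f x| ≤ b * |u|)
    (x y : EuclideanSpace ℝ (Fin d)) : |f x - f y| ≤ b * √d * ‖x - y‖ := by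
  have h := abs_sub_le_sum_of_coord_lipschitz hb y (fun k => x k - y k) Finset.univ
  have hx : y + ∑ k, (x k - y k) • EuclideanSpace.single k (1 : ℝ) = x := by
    ext k
    rw [PiLp.add_apply, sum_smul_single_apply]
    simp
  rw [hx, ← Finset.mul_sum] at h
  refine h.trans ?_
  rw [mul_assoc]
  gcongr
  have hcs := sq_sum_le_card_mul_sum_sq (s := Finset.univ) (f := fun k => |x k - y k|)
  rw [EuclideanSpace.norm_eq, ← Real.sqrt_mul (by positivity)]
  refine Real.le_sqrt_of_sq_le (hcs.trans_eq ?_)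
  simp

lemma exp_le_prod_cosh {l : ℝ} (hl : 0 ≤ l) (hlb : l * b ≤ 1 / 8)
    (ha : ∀ x y : EuclideanSpace ℝ (Fin d), |f x - f y| ≤ a * ‖x - y‖)
    (hb : ∀ (u : ℝ) (x : EuclideanSpace ℝ (Fin d)) (k : Fin d),
      |f (x + u • EuclideanSpace.single k 1) - f x| ≤ b * |u|)
    (x y : EuclideanSpace ℝ (Fin d)) :
    rexp (l * (f x - f y) - 6 * l ^ 2 * a ^ 2) ≤ ∏ k, cosh ((x k - y k) / 4) ^ 2 := by
  set L : Finset (Fin d) := {k | 4 < |x k - y k|} with hL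
  set z := y + ∑ k ∈ L, (x k - y k) • EuclideanSpace.single k (1 : ℝ) with hz
  have h1 : f z - f y ≤ ∑ k ∈ L, b * |x k - y k| :=
    (le_abs_self _).trans (abs_sub_le_sum_of_coord_lipschitz hb y (fun k => x k - y k) L)
  have h2 : f x - f z ≤ a * ‖x - z‖ := (le_abs_self _).trans (ha x z)
  have h3 : ‖x - z‖ ^ 2 = ∑ k, if k ∈ L then 0 else (x k - y k) ^ 2 := by
    rw [EuclideanSpace.norm_sq_eq]
    refine Finset.sum_congr rfl fun k _ => ?_
    rw [hz, PiLp.sub_apply, PiLp.add_apply, sum_smul_single_apply]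
    split_ifs <;> simp
  have h4 : l * (a * ‖x - z‖) ≤ 6 * l ^ 2 * a ^ 2 + ‖x - z‖ ^ 2 / 24 := by
    nlinarith [sq_nonneg (12 * (l * a) - ‖x - z‖)]
  have h5 : l * ∑ k ∈ L, b * |x k - y k| ≤ ∑ k, if k ∈ L then |x k - y k| / 8 else 0 := by
    rw [Finset.sum_ite_mem, Finset.univ_inter, Finset.mul_sum]
    refine Finset.sum_le_sum fun k _ => ?_
    nlinarith [abs_nonneg (x k - y k)]
  have h6 : l * (f x - f y) - 6 * l ^ 2 * a ^ 2 ≤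
      ∑ k, if k ∈ L then |x k - y k| / 8 else (x k - y k) ^ 2 / 24 := by
    have : ∑ k, (if k ∈ L then |x k - y k| / 8 else (x k - y k) ^ 2 / 24) =
        (∑ k, if k ∈ L then |x k - y k| / 8 else 0) +
          (∑ k, if k ∈ L then 0 else (x k - y k) ^ 2) / 24 := by
      rw [Finset.sum_div, ← Finset.sum_add_distrib]
      refine Finset.sum_congr rfl fun k _ => ?_
      split_ifs <;> simp
    rw [this, ← h3]
    have := mul_le_mul_of_nonneg_left (add_le_add h2 h1) hl
    rw [sub_add_sub_cancel, mul_add] at this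
    linarith
  refine (Real.exp_le_exp.2 h6).trans ?_
  rw [Real.exp_sum]
  refine Finset.prod_le_prod (fun k _ => (Real.exp_pos _).le) fun k _ => ?_
  split_ifs with hk
  · exact exp_abs_div_le_cosh (Finset.mem_filter.1 hk).2.le
  · exact exp_sq_div_le_cosh (not_lt.1 fun h => hk (Finset.mem_filter.2 ⟨Finset.mem_univ k, h⟩))

end Lipschitz

lemma ofReal_integral_le_lintegral_ofReal {α : Type*} [MeasurableSpace α] {μ : Measure α}
    {g : α → ℝ} (hg : Integrable g μ) :
    ENNReal.ofReal (∫ x, g x ∂μ) ≤ ∫⁻ x, ENNReal.ofReal (g x) ∂μ := by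
  calc ENNReal.ofReal (∫ x, g x ∂μ) ≤ ENNReal.ofReal (∫ x, max (g x) 0 ∂μ) :=
        ENNReal.ofReal_le_ofReal (integral_mono hg hg.pos_part fun x => le_max_left _ _)
    _ = ∫⁻ x, ENNReal.ofReal (g x) ∂μ := by
        rw [ofReal_integral_eq_lintegral_ofReal hg.pos_part (ae_of_all _ fun x => le_max_right _ _)]
        simp

lemma integrable_sq_symmExp : Integrable (fun x : ℝ => x ^ 2) symmExp :=
  .of_integral_ne_zero (by rw [integral_sq_symmExp]; norm_num)

lemma integrable_eval_sq_pi_symmExp {d : ℕ} (k : Fin d) :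
    Integrable (fun v : Fin d → ℝ => v k ^ 2) (Measure.pi fun _ => symmExp) :=
  (measurePreserving_eval (fun _ : Fin d => symmExp) k).integrable_comp_of_integrable
    integrable_sq_symmExp

lemma integrable_sum_sq_pi_symmExp (d : ℕ) :
    Integrable (fun v : Fin d → ℝ => ∑ k, v k ^ 2) (Measure.pi fun _ => symmExp) :=
  integrable_finsetSum _ fun k _ => integrable_eval_sq_pi_symmExp k

lemma integral_sum_sq_pi_symmExp (d : ℕ) :
    ∫ v : Fin d → ℝ, ∑ k, v k ^ 2 ∂(Measure.pi fun _ => symmExp) = 2 * d := by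
  rw [integral_finsetSum _ fun k _ => integrable_eval_sq_pi_symmExp k]
  have : ∀ k : Fin d, ∫ v : Fin d → ℝ, v k ^ 2 ∂(Measure.pi fun _ => symmExp) = 2 := by
    intro k
    have hmp := measurePreserving_eval (fun _ : Fin d => symmExp) k
    have := integral_map (μ := Measure.pi fun _ : Fin d => symmExp) hmp.measurable.aemeasurable
      (f := fun x : ℝ => x ^ 2) (by fun_prop)
    rw [hmp.map_eq, integral_sq_symmExp] at this
    exact this.symm
  simp [this, mul_comm]

section Lipschitz

variable {d : ℕ} {f : EuclideanSpace ℝ (Fin d) → ℝ} {a : ℝ}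

lemma exp_le_lintegral_exp_neg (hd : 0 < d) {l : ℝ} (hl : 0 ≤ l) (ha0 : 0 ≤ a)
    (ha : ∀ x y : EuclideanSpace ℝ (Fin d), |f x - f y| ≤ a * ‖x - y‖) :
    ENNReal.ofReal (rexp (-(l * (f 0 + a * √(2 * d))))) ≤
      ∫⁻ v, ENNReal.ofReal (rexp (-(l * f (WithLp.toLp 2 v))))
        ∂(Measure.pi fun _ : Fin d => symmExp) := by
  have hd' : (0 : ℝ) < d := Nat.cast_pos.2 hd
  set m := √(2 * d) with hm
  have hm0 : 0 < m := Real.sqrt_pos.2 (by positivity)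
  have hm2 : m ^ 2 = 2 * d := Real.sq_sqrt (by positivity)
  set E := rexp (-(l * (f 0 + a * m))) with hE
  set g : (Fin d → ℝ) → ℝ := fun v => E * (1 + l * a / (2 * m) * (m ^ 2 - ∑ k, v k ^ 2)) with hg
  have hsub : Integrable (fun v : Fin d → ℝ => m ^ 2 - ∑ k, v k ^ 2)
      (Measure.pi fun _ => symmExp) :=
    (integrable_const _).sub (integrable_sum_sq_pi_symmExp d)
  have hgi : Integrable g (Measure.pi fun _ => symmExp) :=
    ((integrable_const _).add (hsub.const_mul _)).const_mul _
  have hgint : ∫ v, g v ∂(Measure.pi fun _ => symmExp) = E := by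
    rw [hg, integral_const_mul, integral_add (integrable_const _) (hsub.const_mul _),
      integral_const_mul, integral_sub (integrable_const _) (integrable_sum_sq_pi_symmExp d),
      integral_sum_sq_pi_symmExp, hm2]
    simp
  rw [← hgint]
  refine (ofReal_integral_le_lintegral_ofReal hgi).trans (lintegral_mono fun v => ?_)
  refine ENNReal.ofReal_le_ofReal ?_
  set r := ‖WithLp.toLp 2 v‖ with hr
  have hr2 : ∑ k, v k ^ 2 = r ^ 2 := by
    rw [hr, EuclideanSpace.norm_sq_eq]
    simp
  have hf : f (WithLp.toLp 2 v) ≤ f 0 + a * r := by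
    have := (le_abs_self _).trans (ha (WithLp.toLp 2 v) 0)
    rw [sub_zero] at this
    linarith
  have h1 : (m ^ 2 - r ^ 2) / (2 * m) ≤ m - r := by
    rw [div_le_iff₀ (by positivity)]
    nlinarith [sq_nonneg (m - r)]
  calc g v = E * (1 + l * a * ((m ^ 2 - r ^ 2) / (2 * m))) := by
        rw [hg, ← hr2]
        ring
    _ ≤ E * (1 + l * a * (m - r)) := by gcongr
    _ ≤ E * rexp (l * a * (m - r)) := by
        gcongr
        linarith [Real.add_one_le_exp (l * a * (m - r))]
    _ = rexp (-(l * (f 0 + a * r))) := by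
        rw [hE, ← Real.exp_add]
        ring_nf
    _ ≤ _ := by gcongr

lemma continuous_of_lipschitz
    (ha : ∀ x y : EuclideanSpace ℝ (Fin d), |f x - f y| ≤ a * ‖x - y‖) : Continuous f :=
  (LipschitzWith.of_dist_le' (K := a) fun x y => by
    rw [Real.dist_eq, dist_eq_norm]
    exact ha x y).continuous

lemma lintegral_exp_le {b l : ℝ} (hd : 0 < d) (hl : 0 ≤ l) (hlb : l * b ≤ 1 / 8) (ha0 : 0 ≤ a)
    (hb0 : 0 ≤ b) (ha : ∀ x y : EuclideanSpace ℝ (Fin d), |f x - f y| ≤ a * ‖x - y‖)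
    (hb : ∀ (u : ℝ) (x : EuclideanSpace ℝ (Fin d)) (k : Fin d),
      |f (x + u • EuclideanSpace.single k 1) - f x| ≤ b * |u|) :
    ∫⁻ v, ENNReal.ofReal (rexp (l * f (WithLp.toLp 2 v))) ∂(Measure.pi fun _ : Fin d => symmExp) ≤
      ENNReal.ofReal (rexp (6 * l ^ 2 * (a * b * √d) + l * (f 0 + a * √(2 * d)))) := by
  obtain ⟨A, hA, hAL⟩ : ∃ A, A ^ 2 ≤ a * b * √d ∧
      ∀ x y : EuclideanSpace ℝ (Fin d), |f x - f y| ≤ A * ‖x - y‖ := by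
    rcases le_total a (b * √d) with h | h
    · exact ⟨a, by nlinarith, ha⟩
    · refine ⟨b * √d, ?_, lipschitz_of_coord_lipschitz hb0 hb⟩
      have : 0 ≤ b * √d := by positivity
      nlinarith
  have hfc := continuous_of_lipschitz ha
  have hfm : Measurable fun v : Fin d → ℝ => f (WithLp.toLp 2 v) :=
    (hfc.comp (PiLp.continuous_toLp 2 _)).measurable
  set V := 6 * l ^ 2 * A ^ 2 with hV
  have hmul := lintegral_mul_lintegral_pi_symmExp_le
    (F := fun v : Fin d → ℝ => ENNReal.ofReal (rexp (-V)) *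
      ENNReal.ofReal (rexp (l * f (WithLp.toLp 2 v))))
    (G := fun v : Fin d → ℝ => ENNReal.ofReal (rexp (-(l * f (WithLp.toLp 2 v)))))
    (by fun_prop) (by fun_prop) (fun x y => by
      rw [← ENNReal.ofReal_mul (Real.exp_pos _).le, ← ENNReal.ofReal_mul (by positivity),
        ← Real.exp_add, ← Real.exp_add]
      refine ENNReal.ofReal_le_ofReal (le_trans (le_of_eq ?_)
        (exp_le_prod_cosh hl hlb hAL hb (WithLp.toLp 2 x) (WithLp.toLp 2 y)))
      congr 1
      ring)
  rw [lintegral_const_mul _ (by fun_prop)] at hmul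
  set I := ∫⁻ v, ENNReal.ofReal (rexp (l * f (WithLp.toLp 2 v)))
    ∂(Measure.pi fun _ : Fin d => symmExp) with hI
  set M := l * (f 0 + a * √(2 * d)) with hM
  have h1 : ENNReal.ofReal (rexp (-V)) * I * ENNReal.ofReal (rexp (-M)) ≤ 1 :=
    (mul_le_mul_right (exp_le_lintegral_exp_neg hd hl ha0 ha) _).trans hmul
  have h2 : ENNReal.ofReal (rexp (V + M)) *
      (ENNReal.ofReal (rexp (-V)) * ENNReal.ofReal (rexp (-M))) = 1 := by
    rw [← ENNReal.ofReal_mul (Real.exp_pos _).le, ← ENNReal.ofReal_mul (Real.exp_pos _).le,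
      ← Real.exp_add, ← Real.exp_add, ← neg_add, add_neg_cancel, Real.exp_zero,
      ENNReal.ofReal_one]
  calc I = ENNReal.ofReal (rexp (V + M)) *
        (ENNReal.ofReal (rexp (-V)) * I * ENNReal.ofReal (rexp (-M))) := by
        rw [mul_right_comm, ← mul_assoc, h2, one_mul]
    _ ≤ ENNReal.ofReal (rexp (V + M)) := mul_le_of_le_one_right' h1
    _ ≤ _ := by
        refine ENNReal.ofReal_le_ofReal (Real.exp_le_exp.2 ?_)
        rw [hV]
        gcongr

/-- Bernstein-type deviation inequality for functions of independent two-sided exponential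
variables. -/
lemma measure_ge_le {b : ℝ} (hd : 0 < d) (ha0 : 0 < a)
    (hb0 : 0 < b) (ha : ∀ x y : EuclideanSpace ℝ (Fin d), |f x - f y| ≤ a * ‖x - y‖)
    (hb : ∀ (u : ℝ) (x : EuclideanSpace ℝ (Fin d)) (k : Fin d),
      |f (x + u • EuclideanSpace.single k 1) - f x| ≤ b * |u|) {x : ℝ} (hx : 0 < x) :
    (Measure.pi fun _ : Fin d => symmExp)
        {v | f 0 + a * √(2 * d) + x ≤ f (WithLp.toLp 2 v)} ≤
      ENNReal.ofReal (rexp (-(1 / 24) * min (x / b) (x ^ 2 / (a * b * √d)))) := by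
  have hd' : (0 : ℝ) < d := Nat.cast_pos.2 hd
  set A := a * b * √d with hA
  have hA0 : 0 < A := by positivity
  set R := f 0 + a * √(2 * d) with hR
  set l := min (1 / (8 * b)) (x / (12 * A)) with hl
  have hl0 : 0 < l := lt_min (by positivity) (by positivity)
  have hlb : l * b ≤ 1 / 8 := by
    calc l * b ≤ 1 / (8 * b) * b := by gcongr; exact min_le_left _ _
      _ = 1 / 8 := by field_simp
  have hlA : 12 * A * l ≤ x := by
    calc 12 * A * l ≤ 12 * A * (x / (12 * A)) := by gcongr; exact min_le_right _ _
      _ = x := by field_simp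
  have hfm : Measurable fun v : Fin d → ℝ => f (WithLp.toLp 2 v) :=
    ((continuous_of_lipschitz ha).comp (PiLp.continuous_toLp 2 _)).measurable
  have hmarkov := mul_meas_ge_le_lintegral (μ := Measure.pi fun _ : Fin d => symmExp)
    (f := fun v => ENNReal.ofReal (rexp (l * f (WithLp.toLp 2 v))))
    (hfm.const_mul l).exp.ennreal_ofReal (ENNReal.ofReal (rexp (l * (R + x))))
  have hset : {v : Fin d → ℝ | R + x ≤ f (WithLp.toLp 2 v)} ⊆
      {v | ENNReal.ofReal (rexp (l * (R + x))) ≤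
        ENNReal.ofReal (rexp (l * f (WithLp.toLp 2 v)))} := fun v hv =>
    ENNReal.ofReal_le_ofReal (Real.exp_le_exp.2 (mul_le_mul_of_nonneg_left hv hl0.le))
  have h1 := (hmarkov.trans (lintegral_exp_le hd hl0.le hlb ha0.le hb0.le ha hb))
  rw [mul_comm, ← ENNReal.le_div_iff_mul_le (by simp [Real.exp_pos]) (by simp),
    ← ENNReal.ofReal_div_of_pos (Real.exp_pos _), ← Real.exp_sub] at h1
  refine (measure_mono hset).trans (h1.trans (ENNReal.ofReal_le_ofReal (Real.exp_le_exp.2 ?_)))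
  have h2 : 1 / 24 * min (x / b) (x ^ 2 / A) ≤ l * x / 2 := by
    rw [hl, min_mul_of_nonneg _ _ hx.le]
    rcases min_cases (1 / (8 * b) * x) (x / (12 * A) * x) with ⟨h, -⟩ | ⟨h, -⟩ <;> rw [h]
    · calc 1 / 24 * min (x / b) (x ^ 2 / A) ≤ 1 / 16 * (x / b) := by
            have := min_le_left (x / b) (x ^ 2 / A)
            have : 0 ≤ x / b := by positivity
            linarith
        _ = _ := by field_simp; norm_num
    · calc 1 / 24 * min (x / b) (x ^ 2 / A) ≤ 1 / 24 * (x ^ 2 / A) := by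
            gcongr
            exact min_le_right _ _
        _ = _ := by field_simp; norm_num
  nlinarith [mul_le_mul_of_nonneg_left hlA hl0.le]

end Lipschitz

/-- Remark (ii) after Theorem 3 of the paper: there is a universal constant `c > 0`
(independent of the dimension) such that for any vector `X` of i.i.d. two-sided
(symmetric) exponential random variables and any `f` Lipschitz with Euclidean constant
`a > 0` and coordinatewise constants `bₖ` with `b = maxₖ bₖ > 0`, for all `x > 0` and
`ε > 0`, `P(f(X) ≥ f(0) + a√(2d) + aε + x) ≤ exp(−c min(x/b, x²/(ab√d + 2abd/ε)))`. -/
theorem stmt18 :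
    ∃ c : ℝ, 0 < c ∧
      ∀ (d : ℕ) (Ω : Type) (_ : MeasureSpace Ω),
        IsProbabilityMeasure (ℙ : Measure Ω) →
        ∀ (X : Ω → EuclideanSpace ℝ (Fin d)), Measurable X →
        Measure.map (fun ω k => X ω k) ℙ =
          (Measure.pi fun _ : Fin d =>
            (volume : Measure ℝ).withDensity fun t =>
              ENNReal.ofReal ((1/2) * Real.exp (-|t|))) →
        ∀ (f : EuclideanSpace ℝ (Fin d) → ℝ) (a : ℝ), 0 < a →
        (∀ x y : EuclideanSpace ℝ (Fin d), |f x - f y| ≤ a * ‖x - y‖) →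
        ∀ (bk : Fin d → ℝ) (b : ℝ),
        (∀ (u : ℝ) (x : EuclideanSpace ℝ (Fin d)) (k : Fin d),
          |f (x + u • EuclideanSpace.single k 1) - f x| ≤ bk k * |u|) →
        IsGreatest (Set.range bk) b → 0 < b →
        ∀ x : ℝ, 0 < x → ∀ ε : ℝ, 0 < ε →
        ℙ {ω | f (X ω) ≥ f 0 + a * Real.sqrt (2 * d) + a * ε + x} ≤
          ENNReal.ofReal (Real.exp (-c * min (x / b)
            (x ^ 2 / (a * b * Real.sqrt d + 2 * a * b * d / ε)))) := by
  refine ⟨1 / 24, by norm_num, ?_⟩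
  intro d Ω _ _ X hX hlaw f a ha0 ha bk b hbk hb hb0 x hx ε hε
  obtain ⟨k₀, -⟩ := hb.1
  have hd : 0 < d := k₀.pos
  have hd' : (0 : ℝ) < d := Nat.cast_pos.2 hd
  have hcoord : ∀ (u : ℝ) (x : EuclideanSpace ℝ (Fin d)) (k : Fin d),
      |f (x + u • EuclideanSpace.single k 1) - f x| ≤ b * |u| := fun u x k =>
    (hbk u x k).trans (mul_le_mul_of_nonneg_right (hb.2 ⟨k, rfl⟩) (abs_nonneg u))
  have hcX : Measurable fun ω k => X ω k := by fun_prop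
  have hfm : Measurable fun v : Fin d → ℝ => f (WithLp.toLp 2 v) :=
    ((continuous_of_lipschitz ha).comp (PiLp.continuous_toLp 2 _)).measurable
  calc ℙ {ω | f (X ω) ≥ f 0 + a * √(2 * d) + a * ε + x}
      ≤ ℙ ((fun ω k => X ω k) ⁻¹' {v | f 0 + a * √(2 * d) + x ≤ f (WithLp.toLp 2 v)}) := by
        refine measure_mono fun ω hω => ?_
        have : f 0 + a * √(2 * d) + a * ε + x ≤ f (X ω) := hω
        change f 0 + a * √(2 * d) + x ≤ f (X ω)
        have := mul_pos ha0 hε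
        linarith
    _ = (Measure.pi fun _ : Fin d => symmExp)
          {v | f 0 + a * √(2 * d) + x ≤ f (WithLp.toLp 2 v)} := by
        rw [← Measure.map_apply hcX (measurableSet_le measurable_const hfm), hlaw]
        rfl
    _ ≤ ENNReal.ofReal (rexp (-(1 / 24) * min (x / b) (x ^ 2 / (a * b * √d)))) :=
        measure_ge_le hd ha0 hb0 ha hcoord hx
    _ ≤ _ := by
        refine ENNReal.ofReal_le_ofReal (Real.exp_le_exp.2 ?_)
        refine mul_le_mul_of_nonpos_left (min_le_min_left _ ?_) (by norm_num)
        gcongr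
        exact le_add_of_nonneg_right (by positivity)
end

section
/- Let λ > 0, let X = (X₁,…,X_d) be a random vector whose components are i.i.d., each Poisson distributed with parameter λ, and let f : ℝ^d → ℝ be Lipschitz with constant a > 0 with respect to the Euclidean norm ‖·‖. Then for all x > 0, P( f(X) ≥ E f(X) + a·√(2λd) + a·x ) ≤ exp( −(8λ + 2)·ℓ( x/(8λ + 2) ) ), where ℓ(u) = (1+u)log(1+u) − u. -/
open MeasureTheory ProbabilityTheory Real
open scoped ENNReal NNReal

/-- The `L²` distance from the point `n` to a random vector with i.i.d. Poisson components. -/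
noncomputable def poissonL2Dist (lam : ℝ≥0) {d : ℕ} (n : Fin d → ℕ) : ℝ :=
  √(∑ k, ((n k : ℝ) - lam) ^ 2 + lam * d)

lemma poissonMeasure_singleton_succ (lam : ℝ≥0) (n : ℕ) :
    ((n + 1 : ℕ) : ℝ≥0∞) * poissonMeasure lam {n + 1} = lam * poissonMeasure lam {n} := by
  rw [poissonMeasure_singleton, poissonMeasure_singleton, ← ENNReal.ofReal_natCast,
    ← ENNReal.ofReal_coe_nnreal, ← ENNReal.ofReal_mul (by positivity),
    ← ENNReal.ofReal_mul (by positivity)]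
  congr 1
  rw [Nat.factorial_succ]
  push_cast
  field_simp
  ring

/-- **Mecke's formula** for i.i.d. Poisson variables, at the level of measures. -/
lemma withDensity_pi_poissonMeasure (lam : ℝ≥0) {d : ℕ} (k : Fin d) :
    (Measure.pi fun _ : Fin d => poissonMeasure lam).withDensity
        (fun n => ((n k : ℝ≥0) : ℝ≥0∞)) =
      lam • (Measure.pi fun _ : Fin d => poissonMeasure lam).map (fun n => n + Pi.single k 1) := by
  refine Measure.ext_of_singleton fun n => ?_
  rw [withDensity_apply _ (measurableSet_singleton _), Measure.restrict_singleton,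
    lintegral_smul_measure, lintegral_dirac, Measure.smul_apply,
    Measure.map_apply .of_discrete (measurableSet_singleton _), Measure.pi_singleton]
  rcases hn : n k with _ | m
  · have : (fun n : Fin d → ℕ => n + Pi.single k 1) ⁻¹' {n} = ∅ := by
      ext l
      simp only [Set.mem_preimage, Set.mem_singleton_iff, Set.mem_empty_iff_false, iff_false]
      intro h
      have := congrFun h k
      simp [hn] at this
    simp [this]
  · have hpre : (fun n : Fin d → ℕ => n + Pi.single k 1) ⁻¹' {n} = {Function.update n k m} := by
      ext l
      simp only [Set.mem_preimage, Set.mem_singleton_iff, funext_iff]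
      refine forall_congr' fun i => ?_
      by_cases h : i = k
      · subst h; simp [hn]
      · simp [h]
    rw [hpre, Measure.pi_singleton, ← Finset.mul_prod_erase _ _ (Finset.mem_univ k),
      ← Finset.mul_prod_erase Finset.univ (fun i => poissonMeasure lam {Function.update n k m i})
        (Finset.mem_univ k)]
    have hprod : ∏ i ∈ Finset.univ.erase k, poissonMeasure lam {Function.update n k m i} =
        ∏ i ∈ Finset.univ.erase k, poissonMeasure lam {n i} :=
      Finset.prod_congr rfl fun i hi => by rw [Function.update_of_ne (Finset.ne_of_mem_erase hi)]
    have := poissonMeasure_singleton_succ lam m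
    rw [hprod, Function.update_self, hn, ENNReal.smul_def, smul_eq_mul, smul_eq_mul, ← mul_assoc,
      ← this]
    push_cast
    ring

lemma integral_eval_mul_pi_poissonMeasure (lam : ℝ≥0) {d : ℕ} (k : Fin d)
    (F : (Fin d → ℕ) → ℝ) :
    ∫ n, (n k : ℝ) * F n ∂(Measure.pi fun _ : Fin d => poissonMeasure lam) =
      lam * ∫ n, F (n + Pi.single k 1) ∂(Measure.pi fun _ : Fin d => poissonMeasure lam) := by
  have h := congrArg (fun μ => ∫ n, F n ∂μ) (withDensity_pi_poissonMeasure lam k)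
  simp only at h
  rw [integral_withDensity_eq_integral_smul .of_discrete, integral_smul_nnreal_measure,
    integral_map .of_discrete .of_discrete] at h
  simpa [NNReal.smul_def] using h

lemma integrable_exp_mul_poissonMeasure (lam : ℝ≥0) (t : ℝ) :
    Integrable (fun n : ℕ => exp (t * n)) (poissonMeasure lam) := by
  rw [integrable_poissonMeasure_iff]
  refine ((Real.summable_pow_div_factorial (lam * exp t)).mul_left (exp (-lam))).congr fun n => ?_
  rw [norm_of_nonneg (exp_pos _).le, mul_pow, mul_comm t, exp_nat_mul]
  ring

section

variable (lam : ℝ≥0) {d : ℕ}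

lemma poissonL2Dist_nonneg (n : Fin d → ℕ) : 0 ≤ poissonL2Dist lam n := sqrt_nonneg _

lemma poissonL2Dist_sq (n : Fin d → ℕ) :
    poissonL2Dist lam n ^ 2 = ∑ k, ((n k : ℝ) - lam) ^ 2 + lam * d :=
  sq_sqrt (by positivity)

lemma abs_sub_le_poissonL2Dist (n : Fin d → ℕ) (k : Fin d) :
    |(n k : ℝ) - lam| ≤ poissonL2Dist lam n := by
  refine abs_le_sqrt ?_
  have := Finset.single_le_sum (f := fun k => ((n k : ℝ) - lam) ^ 2) (fun _ _ => sq_nonneg _)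
    (Finset.mem_univ k)
  have h2 : (0 : ℝ) ≤ lam * d := by positivity
  linarith

lemma poissonL2Dist_add_single_sq (n : Fin d → ℕ) (k : Fin d) :
    poissonL2Dist lam (n + Pi.single k 1) ^ 2 =
      poissonL2Dist lam n ^ 2 + 2 * ((n k : ℝ) - lam) + 1 := by
  rw [poissonL2Dist_sq, poissonL2Dist_sq, ← Finset.add_sum_erase _ _ (Finset.mem_univ k),
    ← Finset.add_sum_erase Finset.univ (fun k => ((n k : ℝ) - lam) ^ 2) (Finset.mem_univ k)]
  have : ∑ i ∈ Finset.univ.erase k, (((n + Pi.single k 1 : Fin d → ℕ) i : ℝ) - lam) ^ 2 =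
      ∑ i ∈ Finset.univ.erase k, ((n i : ℝ) - lam) ^ 2 :=
    Finset.sum_congr rfl fun i hi => by simp [Finset.ne_of_mem_erase hi]
  rw [this]
  simp
  ring

lemma poissonL2Dist_le (n : Fin d → ℕ) :
    poissonL2Dist lam n ≤ ∑ k, (n k : ℝ) + (lam * d + 1) := by
  have h0 : (0 : ℝ) ≤ lam * d := by positivity
  have h1 : (0 : ℝ) ≤ ∑ k, (n k : ℝ) := by positivity
  refine sqrt_le_iff.2 ⟨by positivity, ?_⟩
  have h2 : ∑ k, ((n k : ℝ) - lam) ^ 2 ≤ (∑ k, ((n k : ℝ) + lam)) ^ 2 := by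
    refine le_trans (Finset.sum_le_sum fun k _ => ?_)
      (Finset.sum_sq_le_sq_sum_of_nonneg fun k _ => by positivity)
    have : (0 : ℝ) ≤ n k * lam := by positivity
    nlinarith
  rw [Finset.sum_add_distrib, Finset.sum_const, Finset.card_univ, Fintype.card_fin,
    nsmul_eq_mul] at h2
  nlinarith

lemma integrable_exp_mul_poissonL2Dist (t : ℝ) :
    Integrable (fun n : Fin d → ℕ => exp (t * poissonL2Dist lam n))
      (Measure.pi fun _ => poissonMeasure lam) := by
  have h : Integrable (fun n : Fin d → ℕ => (∏ k, exp (|t| * n k)) * exp (|t| * (lam * d + 1)))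
      (Measure.pi fun _ => poissonMeasure lam) :=
    (Integrable.fintype_prod fun k => integrable_exp_mul_poissonMeasure lam |t|).mul_const _
  refine h.mono' .of_discrete (.of_forall fun n => ?_)
  rw [norm_of_nonneg (exp_pos _).le, ← exp_sum, ← exp_add, ← Finset.mul_sum, ← mul_add, exp_le_exp]
  exact (mul_le_mul_of_nonneg_right (le_abs_self t) (poissonL2Dist_nonneg lam n)).trans
    (mul_le_mul_of_nonneg_left (poissonL2Dist_le lam n) (abs_nonneg t))

lemma integrable_pow_mul_exp_mul_poissonL2Dist (t : ℝ) (p : ℕ) :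
    Integrable (fun n : Fin d → ℕ => poissonL2Dist lam n ^ p * exp (t * poissonL2Dist lam n))
      (Measure.pi fun _ => poissonMeasure lam) := by
  refine integrable_pow_mul_exp_of_mem_interior_integrableExpSet ?_ p
  have : integrableExpSet (poissonL2Dist lam (d := d)) (Measure.pi fun _ => poissonMeasure lam) =
      Set.univ := Set.eq_univ_of_forall fun s => integrable_exp_mul_poissonL2Dist lam s
  simp [this]

lemma mul_exp_sub_one_le {t M H P : ℝ} (ht : 0 ≤ t) (hH : |M| ≤ H) (hP : 0 ≤ P)
    (hPH : P ^ 2 = H ^ 2 + 2 * M + 1) :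
    H * ((M + 1) * (exp (t * P) - exp (t * H))) ≤
      (exp t - 1) * (8 * M ^ 2 + 2) * exp (t * H) := by
  have hH0 : 0 ≤ H := (abs_nonneg M).trans hH
  obtain ⟨hM1, hM2⟩ := abs_le.1 hH
  have hle : P ≤ H + 1 := by nlinarith
  have hexp : exp (t * P) - exp (t * H) = (exp (t * (P - H)) - 1) * exp (t * H) := by
    rw [sub_mul, ← exp_add]; ring_nf
  have ht1 : t ≤ exp t - 1 := by linarith [add_one_le_exp t]
  have hsum : (P - H) * (P + H) = 2 * M + 1 := by linear_combination hPH
  rw [hexp, ← mul_assoc, ← mul_assoc]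
  refine mul_le_mul_of_nonneg_right ?_ (exp_pos _).le
  rcases le_total 0 (P - H) with hD | hD
  · have hc : exp (t * (P - H)) - 1 ≤ (P - H) * (exp t - 1) := by
      have := convexOn_exp.2 (Set.mem_univ 0) (Set.mem_univ t)
        (show 0 ≤ 1 - (P - H) by linarith) hD (by ring)
      simp only [smul_eq_mul, mul_zero, zero_add, exp_zero] at this
      rw [mul_comm t]
      linarith
    have hM : 0 ≤ M + 1 := by nlinarith
    have h1 : H * (P - H) ≤ 2 * M + 1 := by nlinarith
    calc H * (M + 1) * (exp (t * (P - H)) - 1)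
        ≤ H * (M + 1) * ((P - H) * (exp t - 1)) := by gcongr
      _ = (exp t - 1) * ((M + 1) * (H * (P - H))) := by ring
      _ ≤ (exp t - 1) * (8 * M ^ 2 + 2) := by
        refine mul_le_mul_of_nonneg_left ?_ (by linarith)
        nlinarith [sq_nonneg (4 * M - 1)]
  · have hneg : exp (t * (P - H)) - 1 ≤ 0 := by
      rw [sub_nonpos, exp_le_one_iff]
      exact mul_nonpos_of_nonneg_of_nonpos ht hD
    have hrhs : 0 ≤ (exp t - 1) * (8 * M ^ 2 + 2) := mul_nonneg (by linarith) (by positivity)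
    rcases le_total 0 (M + 1) with hM | hM
    · exact (mul_nonpos_of_nonneg_of_nonpos (by positivity) hneg).trans hrhs
    · have hc : 1 - exp (t * (P - H)) ≤ (exp t - 1) * (H - P) := by
        have := add_one_le_exp (t * (P - H))
        nlinarith
      have h1 : H * (H - P) ≤ -(2 * M + 1) := by nlinarith
      calc H * (M + 1) * (exp (t * (P - H)) - 1)
          = H * (-(M + 1)) * (1 - exp (t * (P - H))) := by ring
        _ ≤ H * (-(M + 1)) * ((exp t - 1) * (H - P)) := by
          refine mul_le_mul_of_nonneg_left hc (mul_nonneg hH0 (by linarith))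
        _ = (exp t - 1) * (-(M + 1) * (H * (H - P))) := by ring
        _ ≤ (exp t - 1) * (8 * M ^ 2 + 2) := by
          refine mul_le_mul_of_nonneg_left ?_ (by linarith)
          nlinarith [sq_nonneg (4 * M - 1)]

lemma poissonL2Dist_add_single_le (n : Fin d → ℕ) (k : Fin d) :
    poissonL2Dist lam (n + Pi.single k 1) ≤ poissonL2Dist lam n + 1 := by
  have h0 := poissonL2Dist_nonneg lam n
  have h1 := poissonL2Dist_nonneg lam (n + Pi.single k 1)
  have h2 := poissonL2Dist_add_single_sq lam n k
  have h3 := (abs_le.1 (abs_sub_le_poissonL2Dist lam n k)).2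
  nlinarith

lemma integrable_of_abs_le_mul_exp_mul_poissonL2Dist {t C : ℝ} {p : ℕ} {F : (Fin d → ℕ) → ℝ}
    (hF : ∀ n, |F n| ≤ C * (poissonL2Dist lam n ^ p * exp (t * poissonL2Dist lam n))) :
    Integrable F (Measure.pi fun _ => poissonMeasure lam) :=
  ((integrable_pow_mul_exp_mul_poissonL2Dist lam t p).const_mul C).mono' .of_discrete
    (.of_forall hF)

lemma integral_sq_sub_mul_exp_mul_poissonL2Dist {t : ℝ} (ht : 0 ≤ t) (k : Fin d) :
    Integrable (fun n : Fin d → ℕ => ((n k : ℝ) - lam + 1) *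
      (exp (t * poissonL2Dist lam (n + Pi.single k 1)) - exp (t * poissonL2Dist lam n)))
      (Measure.pi fun _ => poissonMeasure lam) ∧
    Integrable (fun n : Fin d → ℕ => (((n k : ℝ) - lam) ^ 2 - lam) * exp (t * poissonL2Dist lam n))
      (Measure.pi fun _ => poissonMeasure lam) ∧
    ∫ n, (((n k : ℝ) - lam) ^ 2 - lam) * exp (t * poissonL2Dist lam n)
        ∂(Measure.pi fun _ : Fin d => poissonMeasure lam) =
      lam * ∫ n, ((n k : ℝ) - lam + 1) *
        (exp (t * poissonL2Dist lam (n + Pi.single k 1)) - exp (t * poissonL2Dist lam n))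
        ∂(Measure.pi fun _ : Fin d => poissonMeasure lam) := by
  set μ := Measure.pi fun _ : Fin d => poissonMeasure lam
  have hE : Integrable (fun n : Fin d → ℕ => exp (t * poissonL2Dist lam n)) μ :=
    integrable_exp_mul_poissonL2Dist lam t
  have hME : Integrable (fun n : Fin d → ℕ => ((n k : ℝ) - lam) * exp (t * poissonL2Dist lam n))
      μ := by
    refine integrable_of_abs_le_mul_exp_mul_poissonL2Dist lam (C := 1) (p := 1) (t := t)
      fun n => ?_
    rw [abs_mul, abs_exp, one_mul, pow_one]
    exact mul_le_mul_of_nonneg_right (abs_sub_le_poissonL2Dist lam n k) (exp_pos _).le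
  have hM2E : Integrable
      (fun n : Fin d → ℕ => ((n k : ℝ) - lam) ^ 2 * exp (t * poissonL2Dist lam n)) μ := by
    refine integrable_of_abs_le_mul_exp_mul_poissonL2Dist lam (C := 1) (p := 2) (t := t)
      fun n => ?_
    rw [abs_mul, abs_exp, one_mul, abs_pow]
    have := abs_sub_le_poissonL2Dist lam n k
    gcongr
  have hshift : Integrable (fun n : Fin d → ℕ => ((n k : ℝ) - lam + 1) *
      exp (t * poissonL2Dist lam (n + Pi.single k 1))) μ := by
    have hb := ((integrable_pow_mul_exp_mul_poissonL2Dist lam (d := d) t 1).add hE).const_mul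
      (exp t)
    refine hb.mono' .of_discrete (.of_forall fun n => ?_)
    have h1 := abs_sub_le_poissonL2Dist lam n k
    have h2 : exp (t * poissonL2Dist lam (n + Pi.single k 1)) ≤
        exp t * exp (t * poissonL2Dist lam n) := by
      rw [← exp_add, exp_le_exp]
      nlinarith [poissonL2Dist_add_single_le lam n k]
    have h3 : |(n k : ℝ) - lam + 1| ≤ poissonL2Dist lam n + 1 :=
      (abs_add_le _ _).trans (by rw [abs_one]; gcongr)
    rw [norm_eq_abs, abs_mul, abs_exp]
    calc _ ≤ (poissonL2Dist lam n + 1) * (exp t * exp (t * poissonL2Dist lam n)) := by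
          gcongr
          exact add_nonneg (poissonL2Dist_nonneg lam n) zero_le_one
      _ = _ := by simp only [Pi.add_apply]; ring
  have hmecke := integral_eval_mul_pi_poissonMeasure lam k
    fun n => ((n k : ℝ) - lam) * exp (t * poissonL2Dist lam n)
  have hM1E : Integrable
      (fun n : Fin d → ℕ => ((n k : ℝ) - lam + 1) * exp (t * poissonL2Dist lam n)) μ :=
    (hME.add hE).congr (.of_forall fun n => by simp only [Pi.add_apply]; ring)
  refine ⟨(hshift.sub hM1E).congr (.of_forall fun n => by simp only [Pi.sub_apply]; ring),
    (hM2E.sub (hE.const_mul _)).congr (.of_forall fun n => by simp only [Pi.sub_apply]; ring), ?_⟩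
  have e1 : ∫ n, (n k : ℝ) * (((n k : ℝ) - lam) * exp (t * poissonL2Dist lam n)) ∂μ =
      ∫ n, ((n k : ℝ) - lam) ^ 2 * exp (t * poissonL2Dist lam n) ∂μ +
        lam * ∫ n, ((n k : ℝ) - lam) * exp (t * poissonL2Dist lam n) ∂μ := by
    rw [← integral_const_mul, ← integral_add hM2E (hME.const_mul _)]
    congr with n
    ring
  have e2 : ∫ n, (((n k : ℝ) - lam) ^ 2 - lam) * exp (t * poissonL2Dist lam n) ∂μ =
      ∫ n, ((n k : ℝ) - lam) ^ 2 * exp (t * poissonL2Dist lam n) ∂μ -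
        lam * ∫ n, exp (t * poissonL2Dist lam n) ∂μ := by
    rw [← integral_const_mul, ← integral_sub hM2E (hE.const_mul _)]
    congr with n
    ring
  have e3 : ∫ n, ((n k : ℝ) - lam + 1) *
        (exp (t * poissonL2Dist lam (n + Pi.single k 1)) - exp (t * poissonL2Dist lam n)) ∂μ =
      ∫ n, ((n k : ℝ) - lam + 1) * exp (t * poissonL2Dist lam (n + Pi.single k 1)) ∂μ -
        (∫ n, ((n k : ℝ) - lam) * exp (t * poissonL2Dist lam n) ∂μ +
          ∫ n, exp (t * poissonL2Dist lam n) ∂μ) := by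
    rw [← integral_add' hME hE, ← integral_sub' hshift (hME.add hE)]
    congr with n
    simp only [Pi.sub_apply, Pi.add_apply]
    ring
  have e4 : ∫ n : Fin d → ℕ, (((n + Pi.single k 1 : Fin d → ℕ) k : ℝ) - lam) *
        exp (t * poissonL2Dist lam (n + Pi.single k 1)) ∂μ =
      ∫ n, ((n k : ℝ) - lam + 1) * exp (t * poissonL2Dist lam (n + Pi.single k 1)) ∂μ := by
    congr with n
    simp only [Pi.add_apply, Pi.single_eq_same, Nat.cast_add, Nat.cast_one]
    ring
  rw [e4, e1] at hmecke
  rw [e2, e3]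
  linear_combination hmecke

lemma sum_mul_exp_sub_le (hlam : 0 < lam) {t : ℝ} (ht : 0 ≤ t) (n : Fin d → ℕ) :
    lam * ∑ k, ((n k : ℝ) - lam + 1) *
        (exp (t * poissonL2Dist lam (n + Pi.single k 1)) - exp (t * poissonL2Dist lam n)) ≤
      (8 * lam + 2) * (exp t - 1) * (poissonL2Dist lam n * exp (t * poissonL2Dist lam n)) := by
  have hlam' : (0 : ℝ) < lam := hlam
  rcases Nat.eq_zero_or_pos d with rfl | hd
  · simp [poissonL2Dist]
  have hd' : (0 : ℝ) < d := by exact_mod_cast hd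
  have hpos : 0 < poissonL2Dist lam n := sqrt_pos.2 (by positivity)
  have het : 0 ≤ exp t - 1 := by linarith [add_one_le_exp t]
  refine le_of_mul_le_mul_left ?_ hpos
  set E := exp (t * poissonL2Dist lam n)
  have hE : 0 < E := exp_pos _
  calc poissonL2Dist lam n * (lam * ∑ k, ((n k : ℝ) - lam + 1) *
        (exp (t * poissonL2Dist lam (n + Pi.single k 1)) - E))
      = lam * ∑ k, poissonL2Dist lam n * (((n k : ℝ) - lam + 1) *
        (exp (t * poissonL2Dist lam (n + Pi.single k 1)) - E)) := by
        rw [← Finset.mul_sum]; ring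
    _ ≤ lam * ∑ k, (exp t - 1) * (8 * ((n k : ℝ) - lam) ^ 2 + 2) * E := by
        refine mul_le_mul_of_nonneg_left (Finset.sum_le_sum fun k _ => ?_) hlam'.le
        exact mul_exp_sub_one_le ht (abs_sub_le_poissonL2Dist lam n k)
          (poissonL2Dist_nonneg lam _) (poissonL2Dist_add_single_sq lam n k)
    _ = (exp t - 1) * E * (8 * lam * ∑ k, ((n k : ℝ) - lam) ^ 2 + 2 * (lam * d)) := by
        rw [← Finset.sum_mul, ← Finset.mul_sum, Finset.sum_add_distrib, ← Finset.mul_sum]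
        simp only [Finset.sum_const, Finset.card_univ, Fintype.card_fin, nsmul_eq_mul]
        ring
    _ ≤ (exp t - 1) * E * ((8 * lam + 2) * poissonL2Dist lam n ^ 2) := by
        rw [poissonL2Dist_sq]
        have h1 : (0 : ℝ) ≤ ∑ k, ((n k : ℝ) - lam) ^ 2 := by positivity
        have h2 : (0 : ℝ) ≤ lam * (lam * d) := by positivity
        refine mul_le_mul_of_nonneg_left ?_ (by positivity)
        nlinarith
    _ = _ := by ring

lemma integral_sq_sub_mul_exp_le (hlam : 0 < lam) {t : ℝ} (ht : 0 ≤ t) :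
    ∫ n, (poissonL2Dist lam n ^ 2 - 2 * lam * d) * exp (t * poissonL2Dist lam n)
        ∂(Measure.pi fun _ : Fin d => poissonMeasure lam) ≤
      (8 * lam + 2) * (exp t - 1) * ∫ n, poissonL2Dist lam n * exp (t * poissonL2Dist lam n)
        ∂(Measure.pi fun _ : Fin d => poissonMeasure lam) := by
  have h := fun k : Fin d => integral_sq_sub_mul_exp_mul_poissonL2Dist lam ht k
  calc _ = ∫ n, ∑ k, (((n k : ℝ) - lam) ^ 2 - lam) * exp (t * poissonL2Dist lam n)
        ∂(Measure.pi fun _ : Fin d => poissonMeasure lam) := by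
        congr with n
        rw [poissonL2Dist_sq, ← Finset.sum_mul, Finset.sum_sub_distrib]
        simp only [Finset.sum_const, Finset.card_univ, Fintype.card_fin, nsmul_eq_mul]
        ring
    _ = ∫ n, lam * ∑ k, ((n k : ℝ) - lam + 1) *
        (exp (t * poissonL2Dist lam (n + Pi.single k 1)) - exp (t * poissonL2Dist lam n))
        ∂(Measure.pi fun _ : Fin d => poissonMeasure lam) := by
        rw [integral_finsetSum _ fun k _ => (h k).2.1, integral_const_mul,
          integral_finsetSum _ fun k _ => (h k).1, Finset.mul_sum]
        exact Finset.sum_congr rfl fun k _ => (h k).2.2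
    _ ≤ _ := by
        rw [← integral_const_mul]
        refine integral_mono ((integrable_finsetSum _ fun k _ => (h k).1).const_mul _)
          (Integrable.const_mul ?_ _) fun n => sum_mul_exp_sub_le lam hlam ht n
        simpa using integrable_pow_mul_exp_mul_poissonL2Dist lam (d := d) t 1

lemma integral_mul_exp_le (hlam : 0 < lam) {t : ℝ} (ht : 0 < t) :
    ∫ n, poissonL2Dist lam n * exp (t * poissonL2Dist lam n)
        ∂(Measure.pi fun _ : Fin d => poissonMeasure lam) ≤
      (√(2 * lam * d) + (8 * lam + 2) * (exp t - 1)) *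
        mgf (poissonL2Dist lam) (Measure.pi fun _ : Fin d => poissonMeasure lam) t := by
  set s := √(2 * lam * d)
  set c := (8 * (lam : ℝ) + 2) * (exp t - 1)
  set μ := Measure.pi fun _ : Fin d => poissonMeasure lam
  have hs : 0 ≤ s := sqrt_nonneg _
  have hs2 : s ^ 2 = 2 * lam * d := sq_sqrt (by positivity)
  have hc : 0 < c := mul_pos (by positivity) (by linarith [add_one_le_exp t])
  have hint (p : ℕ) := integrable_pow_mul_exp_mul_poissonL2Dist lam (d := d) t p
  have h0 : Integrable (fun n : Fin d → ℕ => exp (t * poissonL2Dist lam n)) μ := by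
    simpa using hint 0
  have h1 : Integrable
      (fun n : Fin d → ℕ => poissonL2Dist lam n * exp (t * poissonL2Dist lam n)) μ := by
    simpa using hint 1
  have h2 : Integrable (fun n : Fin d → ℕ =>
      (poissonL2Dist lam n ^ 2 - 2 * lam * d) * exp (t * poissonL2Dist lam n)) μ :=
    ((hint 2).sub (h0.const_mul (2 * lam * d))).congr (.of_forall fun n => by simp only [Pi.sub_apply]; ring)
  have hmain := integral_sq_sub_mul_exp_le lam (d := d) hlam ht.le
  have hmono := integral_mono ((h1.const_mul (2 * s + c)).sub (h0.const_mul ((2 * s + c) * (s + c))))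
    (h2.sub (h1.const_mul c)) fun n => by
      simp only [Pi.sub_apply]
      rw [← hs2]
      set H := poissonL2Dist lam n
      have hE : 0 ≤ exp (t * H) := (exp_pos _).le
      have : 0 ≤ ((H - s - c) ^ 2 + s * c) * exp (t * H) := by positivity
      linarith
  rw [integral_sub' (h1.const_mul _) (h0.const_mul _), integral_sub' h2 (h1.const_mul c),
    integral_const_mul, integral_const_mul, integral_const_mul] at hmono
  rw [mgf]
  refine le_of_mul_le_mul_left ?_ (show 0 < 2 * s + c by positivity)
  linarith

lemma mgf_poissonL2Dist_le (hlam : 0 < lam) {t : ℝ} (ht : 0 ≤ t) :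
    mgf (poissonL2Dist lam) (Measure.pi fun _ : Fin d => poissonMeasure lam) t ≤
      exp (t * √(2 * lam * d) + (8 * lam + 2) * (exp t - 1 - t)) := by
  set s := √(2 * lam * d)
  set v := 8 * (lam : ℝ) + 2
  set m := mgf (poissonL2Dist lam) (Measure.pi fun _ : Fin d => poissonMeasure lam)
  have hset : integrableExpSet (poissonL2Dist lam) (Measure.pi fun _ : Fin d => poissonMeasure lam)
      = Set.univ := Set.eq_univ_of_forall fun r => integrable_exp_mul_poissonL2Dist lam r
  have hderiv (r : ℝ) : HasDerivAt (fun r => m r * exp (-(r * s + v * (exp r - 1 - r))))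
      ((∫ n, poissonL2Dist lam n * exp (r * poissonL2Dist lam n)
        ∂(Measure.pi fun _ : Fin d => poissonMeasure lam)) *
          exp (-(r * s + v * (exp r - 1 - r))) +
        m r * (exp (-(r * s + v * (exp r - 1 - r))) * -(1 * s + v * (exp r - 1)))) r := by
    refine (hasDerivAt_mgf (by simp [hset])).mul (HasDerivAt.exp ?_)
    exact (((hasDerivAt_id r).mul_const s).add
      ((((hasDerivAt_exp r).sub_const 1).sub (hasDerivAt_id r)).const_mul v)).neg
  have hanti : AntitoneOn (fun r => m r * exp (-(r * s + v * (exp r - 1 - r)))) (Set.Ici 0) := by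
    refine antitoneOn_of_deriv_nonpos (convex_Ici 0)
      (fun r _ => (hderiv r).continuousAt.continuousWithinAt)
      (fun r _ => (hderiv r).differentiableAt.differentiableWithinAt) fun r hr => ?_
    rw [interior_Ici, Set.mem_Ioi] at hr
    rw [(hderiv r).deriv]
    have := mul_le_mul_of_nonneg_right (integral_mul_exp_le lam (d := d) hlam hr)
      (exp_pos (-(r * s + v * (exp r - 1 - r)))).le
    linarith
  have h := hanti Set.self_mem_Ici ht ht
  simp only [m, mgf_zero, zero_mul, exp_zero, sub_self, mul_zero, add_zero, neg_zero,
    mul_one] at h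
  rw [exp_neg, ← div_eq_mul_inv, div_le_one (exp_pos _)] at h
  exact h

lemma measure_poissonL2Dist_ge_le (hlam : 0 < lam) {x : ℝ} (hx : 0 ≤ x) :
    (Measure.pi fun _ : Fin d => poissonMeasure lam).real
        {n | √(2 * lam * d) + x ≤ poissonL2Dist lam n} ≤
      exp (-(8 * (lam : ℝ) + 2) * ((1 + x / (8 * (lam : ℝ) + 2)) *
        log (1 + x / (8 * (lam : ℝ) + 2)) - x / (8 * (lam : ℝ) + 2))) := by
  set v := 8 * (lam : ℝ) + 2 with hv
  have hvpos : 0 < v := by positivity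
  have hu : 0 ≤ x / v := by positivity
  have ht : 0 ≤ log (1 + x / v) := log_nonneg (by linarith)
  refine (measure_ge_le_exp_mul_mgf _ ht (integrable_exp_mul_poissonL2Dist lam _)).trans ?_
  refine (mul_le_mul_of_nonneg_left (mgf_poissonL2Dist_le lam hlam ht) (exp_pos _).le).trans ?_
  rw [← exp_add, exp_log (by linarith), exp_le_exp, ← hv]
  apply le_of_eq
  field_simp
  ring

lemma integrable_eval_pow_pi_poissonMeasure (k : Fin d) (p : ℕ) :
    Integrable (fun n : Fin d → ℕ => (n k : ℝ) ^ p) (Measure.pi fun _ => poissonMeasure lam) := by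
  refine integrable_comp_eval (X := fun _ : Fin d => ℕ) (i := k) (f := fun m : ℕ => (m : ℝ) ^ p) ?_
  exact integrable_pow_of_integrable_exp_mul (t := 1) one_ne_zero
    (integrable_exp_mul_poissonMeasure lam _) (integrable_exp_mul_poissonMeasure lam _) p

lemma integral_sub_eval_sq_pi_poissonMeasure (k : Fin d) (y : ℝ) :
    Integrable (fun n : Fin d → ℕ => (y - n k) ^ 2) (Measure.pi fun _ => poissonMeasure lam) ∧
    ∫ n, (y - n k) ^ 2 ∂(Measure.pi fun _ : Fin d => poissonMeasure lam) =
      (y - lam) ^ 2 + lam := by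
  have h1 : Integrable (fun n : Fin d → ℕ => (n k : ℝ))
      (Measure.pi fun _ => poissonMeasure lam) := by
    simpa using integrable_eval_pow_pi_poissonMeasure lam k 1
  have h2 := integrable_eval_pow_pi_poissonMeasure lam k 2
  have e1 := integral_eval_mul_pi_poissonMeasure lam k fun _ => 1
  have e2 := integral_eval_mul_pi_poissonMeasure lam k fun n => n k
  simp only [mul_one, integral_const, probReal_univ, smul_eq_mul] at e1
  simp only [Pi.add_apply, Pi.single_eq_same, Nat.cast_add, Nat.cast_one, ← pow_two] at e2
  rw [integral_add h1 (integrable_const _), e1] at e2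
  simp only [integral_const, probReal_univ, smul_eq_mul, mul_one] at e2
  have heq : (fun n : Fin d → ℕ => (y - n k) ^ 2) =
      (fun n : Fin d → ℕ => (n k : ℝ) ^ 2) - (fun n : Fin d → ℕ => 2 * y * n k) +
        fun _ => y ^ 2 := by
    ext n
    simp only [Pi.add_apply, Pi.sub_apply]
    ring
  have hsub := h2.sub (h1.const_mul (2 * y))
  rw [heq]
  refine ⟨hsub.add (integrable_const _), ?_⟩
  rw [integral_add' hsub (integrable_const _), integral_sub' h2 (h1.const_mul _),
    integral_const_mul, e1, e2]
  simp only [integral_const, probReal_univ, smul_eq_mul]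
  ring

lemma integral_norm_sub_poisson_le (y : EuclideanSpace ℝ (Fin d)) :
    Integrable (fun n : Fin d → ℕ => ‖y - WithLp.toLp 2 fun k => (n k : ℝ)‖)
      (Measure.pi fun _ => poissonMeasure lam) ∧
    ∫ n, ‖y - WithLp.toLp 2 fun k => (n k : ℝ)‖ ∂(Measure.pi fun _ => poissonMeasure lam) ≤
      √(∑ k, (y k - lam) ^ 2 + lam * d) := by
  set μ := Measure.pi fun _ : Fin d => poissonMeasure lam
  set Z := fun n : Fin d → ℕ => ‖y - WithLp.toLp 2 fun k => (n k : ℝ)‖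
  have hZ : Z ^ 2 = fun n : Fin d → ℕ => ∑ k, (y k - n k) ^ 2 := by
    ext n
    simp [Z, EuclideanSpace.norm_sq_eq]
  have hint : Integrable (fun n : Fin d → ℕ => ∑ k, (y k - n k) ^ 2) μ :=
    integrable_finsetSum _ fun k _ => (integral_sub_eval_sq_pi_poissonMeasure lam k (y k)).1
  have hLp : MemLp Z 2 μ := by
    rw [memLp_two_iff_integrable_sq .of_discrete]
    exact hint.congr (.of_forall fun n => (congrFun hZ n).symm)
  refine ⟨hLp.integrable (by norm_num), le_sqrt_of_sq_le ?_⟩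
  have hvar := variance_nonneg Z μ
  rw [variance_eq_sub hLp, hZ, integral_finsetSum _ fun k _ =>
    (integral_sub_eval_sq_pi_poissonMeasure lam k (y k)).1] at hvar
  simp only [(integral_sub_eval_sq_pi_poissonMeasure lam _ _).2, Finset.sum_add_distrib,
    Finset.sum_const, Finset.card_univ, Fintype.card_fin, nsmul_eq_mul] at hvar
  linarith

lemma sub_integral_le_mul_poissonL2Dist {f : EuclideanSpace ℝ (Fin d) → ℝ} {a : ℝ} (ha : 0 ≤ a)
    (hf : ∀ x y, |f x - f y| ≤ a * ‖x - y‖) (m : Fin d → ℕ) :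
    f (WithLp.toLp 2 fun k => (m k : ℝ)) -
        ∫ n, f (WithLp.toLp 2 fun k => (n k : ℝ)) ∂(Measure.pi fun _ => poissonMeasure lam) ≤
      a * poissonL2Dist lam m := by
  set μ := Measure.pi fun _ : Fin d => poissonMeasure lam
  set y : EuclideanSpace ℝ (Fin d) := WithLp.toLp 2 fun k => (m k : ℝ)
  obtain ⟨hint, hle⟩ := integral_norm_sub_poisson_le lam y
  have hdiff : Integrable (fun n : Fin d → ℕ => f y - f (WithLp.toLp 2 fun k => (n k : ℝ))) μ :=
    (hint.const_mul a).mono' .of_discrete (.of_forall fun n => hf _ _)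
  have hfint : Integrable (fun n : Fin d → ℕ => f (WithLp.toLp 2 fun k => (n k : ℝ))) μ :=
    ((integrable_const (f y)).sub hdiff).congr (.of_forall fun n => by simp)
  calc f y - ∫ n, f (WithLp.toLp 2 fun k => (n k : ℝ)) ∂μ
      = ∫ n, (f y - f (WithLp.toLp 2 fun k => (n k : ℝ))) ∂μ := by
        rw [integral_sub (integrable_const _) hfint]; simp
    _ ≤ ∫ n, a * ‖y - WithLp.toLp 2 fun k => (n k : ℝ)‖ ∂μ :=
        integral_mono hdiff (hint.const_mul a) fun n => (le_abs_self _).trans (hf _ _)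
    _ ≤ a * poissonL2Dist lam m := by
        rw [integral_const_mul]
        exact mul_le_mul_of_nonneg_left hle ha

end

/-- Corollary 6 of the paper (dimension-free Bennett-type bound for Euclidean-Lipschitz
functions) specialized to i.i.d. Poisson(λ) components: for `f` Lipschitz with constant
`a > 0` for the Euclidean norm and all `x > 0`,
`P(f(X) ≥ E f(X) + a√(2λd) + a x) ≤ exp(−(8λ+2) ℓ(x/(8λ+2)))`,
where `ℓ(u) = (1+u)log(1+u) − u`. -/
theorem stmt19
    {Ω : Type*} [MeasureSpace Ω] [IsProbabilityMeasure (ℙ : Measure Ω)]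
    {d : ℕ} (lam : ℝ≥0) (hlam : 0 < lam)
    (X : Ω → EuclideanSpace ℝ (Fin d)) (hX : Measurable X)
    (hlaw : Measure.map (fun ω k => X ω k) ℙ =
      Measure.pi fun _ : Fin d => (poissonMeasure lam).map (fun n : ℕ => (n : ℝ)))
    (f : EuclideanSpace ℝ (Fin d) → ℝ) (a : ℝ) (ha : 0 < a)
    (hf : ∀ x y : EuclideanSpace ℝ (Fin d), |f x - f y| ≤ a * ‖x - y‖)
    (x : ℝ) (hx : 0 < x) :
    ℙ {ω | f (X ω) ≥ (∫ ω', f (X ω')) + a * Real.sqrt (2 * lam * d) + a * x} ≤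
      ENNReal.ofReal (Real.exp (-(8 * (lam : ℝ) + 2) *
        ((1 + x / (8 * (lam : ℝ) + 2)) * Real.log (1 + x / (8 * (lam : ℝ) + 2)) -
          x / (8 * (lam : ℝ) + 2)))) := by
  have hcont : Continuous f :=
    (LipschitzWith.of_dist_le_mul (K := ⟨a, ha.le⟩) fun u w => by
      rw [Real.dist_eq, dist_eq_norm]; exact hf u w).continuous
  have hY : Measurable fun n : Fin d → ℕ =>
      (WithLp.toLp 2 fun k => (n k : ℝ) : EuclideanSpace ℝ (Fin d)) := .of_discrete
  have hmap : Measure.map X ℙ = (Measure.pi fun _ : Fin d => poissonMeasure lam).map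
      fun n => (WithLp.toLp 2 fun k => (n k : ℝ) : EuclideanSpace ℝ (Fin d)) := by
    have hcoord : Measurable fun ω k => X ω k := by fun_prop
    have hto : Measurable (WithLp.toLp 2 : (Fin d → ℝ) → EuclideanSpace ℝ (Fin d)) := by fun_prop
    have h := congrArg (Measure.map (WithLp.toLp 2 : _ → EuclideanSpace ℝ (Fin d))) hlaw
    rw [Measure.map_map hto hcoord, ← Measure.pi_map_pi fun _ => .of_discrete,
      Measure.map_map hto .of_discrete] at h
    exact h
  have hmean : ∫ ω, f (X ω) = ∫ n, f (WithLp.toLp 2 fun k => (n k : ℝ))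
      ∂(Measure.pi fun _ : Fin d => poissonMeasure lam) := by
    rw [← integral_map hX.aemeasurable hcont.aestronglyMeasurable, hmap,
      integral_map hY.aemeasurable hcont.aestronglyMeasurable]
  set b := ∫ ω, f (X ω)
  set s := √(2 * lam * d)
  have hmeas : MeasurableSet {y | f y ≥ b + a * s + a * x} :=
    (isClosed_le continuous_const hcont).measurableSet
  calc ℙ {ω | f (X ω) ≥ b + a * s + a * x}
      = Measure.map X ℙ {y | f y ≥ b + a * s + a * x} := (Measure.map_apply hX hmeas).symm
    _ = (Measure.pi fun _ : Fin d => poissonMeasure lam)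
        {n | f (WithLp.toLp 2 fun k => (n k : ℝ)) ≥ b + a * s + a * x} := by
        rw [hmap, Measure.map_apply hY hmeas, Set.preimage_ofPred_eq]
    _ ≤ (Measure.pi fun _ : Fin d => poissonMeasure lam) {n | s + x ≤ poissonL2Dist lam n} := by
        refine measure_mono fun n hn => ?_
        have h := sub_integral_le_mul_poissonL2Dist lam ha.le hf n
        rw [← hmean] at h
        simp only [Set.mem_ofPred_eq] at hn ⊢
        refine le_of_mul_le_mul_left ?_ ha
        linarith
    _ ≤ _ := by
        rw [← ofReal_measureReal]
        exact ENNReal.ofReal_le_ofReal (measure_poissonL2Dist_ge_le lam hlam hx.le)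
end
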